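/- arXiv:1506.01817 — 4 statements merged into one kernel-verified Lean document; each statement's English description precedes it below -/
import Mathlib

section
/- For p = 3 one has μ_3({a ∈ ℤ_3⁴ : S_a(ℚ_3) ≠ ∅}) = [(1 − 1/3)³/(1 − 1/3³)³] · (1 + 3/3 + 46/(9·3²) + 7/3³ + 62/(9·3⁴) + 19/(9·3⁵) + 1/3⁶). -/
open MeasureTheory

noncomputable instance (p : ℕ) [Fact p.Prime] : MeasurableSpace ℤ_[p] := borel _
instance (p : ℕ) [Fact p.Prime] : BorelSpace ℤ_[p] := ⟨rfl⟩
def dcW (k : ℕ) : ℕ := 3 ^ (2 - k / 3)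
def dcG (k : ℕ) : ℕ := if k % 3 = 0 then 1 else if k % 3 = 1 then 2 else 4
def dcT (i j : ℕ) : ℕ := 3 ^ ((j / 3 + 3 - i / 3) % 3) * dcG j
def dcChk (a b c d : ℕ) : Bool :=
  [0, 1, 8].any fun e => [0, 1, 8].any fun f => [0, 1, 8].any fun g =>
    Nat.beq ((dcG a + dcT a b * e + dcT a c * f + dcT a d * g) % 9) 0
def dcSol (a b c d : ℕ) : Bool :=
  dcChk a b c d || dcChk b a c d || dcChk c a b d || dcChk d a b c

/-- ball -/
def dcB (c : ℤ_[3]) (k : ℕ) : Set ℤ_[3] := {z | (3 : ℤ_[3]) ^ k ∣ z - c}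

theorem dcB_measure (ν : Measure ℤ_[3]) [ν.IsAddHaarMeasure] (hν : ν Set.univ = 1)
    (c : ℤ_[3]) (k : ℕ) : ν (dcB c k) = (3 ^ k : ENNReal)⁻¹ := by
  have h1 : ν (dcB c k) = ν (dcB 0 k) := by
    have : dcB c k = (fun z => z + (-c)) ⁻¹' dcB 0 k := by
      ext z; simp [dcB, sub_eq_add_neg]
    rw [this, measure_preimage_add_right]
  rw [h1]
  let f := (PadicInt.toZModPow (p := 3) k).toAddMonoidHom
  have hker : (f.ker : Set ℤ_[3]) = dcB 0 k := by
    ext z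
    have : z ∈ RingHom.ker (PadicInt.toZModPow (p := 3) k) ↔ (3 : ℤ_[3]) ^ k ∣ z := by
      rw [PadicInt.ker_toZModPow, Ideal.mem_span_singleton]; norm_cast
    simp only [dcB, sub_zero, Set.mem_ofPred_eq, ← this]
    rfl
  have hcl : IsClosed (dcB 0 k) := by
    have : dcB 0 k = {z : ℤ_[3] | ‖z‖ ≤ (3 : ℝ) ^ (-k : ℤ)} := by
      ext z
      have := PadicInt.norm_le_pow_iff_mem_span_pow (p := 3) z k
      rw [Ideal.mem_span_singleton] at this
      simp only [dcB, sub_zero, Set.mem_ofPred_eq]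
      norm_num at this ⊢
      exact this.symm
    rw [this]
    exact isClosed_le continuous_norm continuous_const
  have hidx : f.ker.index = 3 ^ k := by
    rw [AddSubgroup.index_ker]
    have : f.range = ⊤ := AddMonoidHom.range_eq_top.2 (ZMod.ringHom_surjective _)
    rw [this]
    simp
  have : f.ker.FiniteIndex := ⟨by rw [hidx]; positivity⟩
  have := AddSubgroup.index_mul_measure f.ker (by rw [hker]; exact hcl.measurableSet) ν
  rw [hidx, hker, hν] at this
  refine ENNReal.eq_inv_of_mul_eq_one_left ?_
  rw [mul_comm]; exact_mod_cast this

def dcC (k : ℕ) : Set ℤ_[3] :=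
  ⋃ n : ℕ, (dcB (3 ^ (3 * n + k / 3) * dcG k) (3 * n + k / 3 + 2) ∪
    dcB (-(3 ^ (3 * n + k / 3) * dcG k)) (3 * n + k / 3 + 2))

theorem dcC_measure (ν : Measure ℤ_[3]) [ν.IsAddHaarMeasure] (hν : ν Set.univ = 1)
    (k : ℕ) (hk : k < 9) : ν (dcC k) ≤ ENNReal.ofReal (dcW k / 39) := by
  have hsum : HasSum (fun n : ℕ => 2 * (1 / 3 : ℝ) ^ (3 * n + k / 3 + 2)) (dcW k / 39) := by
    have h := (hasSum_geometric_of_lt_one (r := (1 / 27 : ℝ)) (by norm_num) (by norm_num)).mul_left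
      (2 * (1 / 3 : ℝ) ^ (k / 3 + 2))
    have e1 : (fun n : ℕ => 2 * (1 / 3 : ℝ) ^ (3 * n + k / 3 + 2)) =
        fun n : ℕ => 2 * (1 / 3 : ℝ) ^ (k / 3 + 2) * (1 / 27) ^ n := by
      ext n
      have : (1 / 27 : ℝ) = (1 / 3) ^ 3 := by norm_num
      rw [this, ← pow_mul]; ring
    have e2 : (dcW k / 39 : ℝ) = 2 * (1 / 3 : ℝ) ^ (k / 3 + 2) * (1 - 1 / 27)⁻¹ := by
      interval_cases k <;> norm_num [dcW]
    rw [e1, e2]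
    exact h
  refine (measure_iUnion_le _).trans ?_
  rw [← hsum.tsum_eq, ENNReal.ofReal_tsum_of_nonneg (fun n => by positivity) hsum.summable]
  refine ENNReal.tsum_le_tsum fun n => ?_
  refine (measure_union_le _ _).trans ?_
  rw [dcB_measure ν hν, dcB_measure ν hν, ← two_mul, ENNReal.ofReal_mul (by norm_num),
    ENNReal.ofReal_pow (by norm_num), one_div, ENNReal.ofReal_inv_of_pos (by norm_num),
    ENNReal.inv_pow]
  simp

theorem dc_cube (s : ℤ_[3]) : ∃ c : ℤ_[3], c ^ 3 = 1 + 9 * s := by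
  let F : Polynomial ℤ_[3] := Polynomial.X + 3 * Polynomial.X ^ 2 + 3 * Polynomial.X ^ 3
    - Polynomial.C s
  have h3 : ∀ t : ℤ_[3], ‖3 * t‖ < 1 := fun t => by
    have h : ‖(3 : ℤ_[3])‖ = 3⁻¹ := by simpa using PadicInt.norm_p (p := 3)
    rw [norm_mul, h]
    have := PadicInt.norm_le_one t
    linarith
  have hd : ‖F.derivative.aeval s‖ = 1 := by
    have : F.derivative.aeval s = 1 + 3 * (2 * s + 3 * s ^ 2) := by
      simp [F, Polynomial.derivative_pow]; ring
    rw [this]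
    have := h3 (2 * s + 3 * s ^ 2)
    have h1 : ‖(1 : ℤ_[3])‖ = 1 := by simp
    rw [PadicInt.norm_add_eq_max_of_ne (by rw [h1]; exact this.ne'), h1]
    exact max_eq_left this.le
  obtain ⟨z, hz, -⟩ := hensels_lemma (F := F) (a := s) (by
    rw [hd]
    have : F.aeval s = 3 * (s ^ 2 + s ^ 3) := by simp [F]; ring
    rw [this]; simpa using h3 _)
  refine ⟨1 + 3 * z, ?_⟩
  have : z + 3 * z ^ 2 + 3 * z ^ 3 - s = 0 := by simpa [F] using hz
  linear_combination 9 * this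

theorem dc_mod9 (u : ℤ_[3]) : ∃ m : ℕ, m < 9 ∧ ∃ s : ℤ_[3], u = m + 9 * s := by
  refine ⟨u.appr 2, by simpa using PadicInt.appr_lt u 2, ?_⟩
  have := PadicInt.appr_spec 2 u
  rw [Ideal.mem_span_singleton] at this
  obtain ⟨s, hs⟩ := this
  refine ⟨s, ?_⟩
  push_cast at hs
  linear_combination hs

theorem dc_three_not_unit (s : ℤ_[3]) : ¬ IsUnit (3 * s) := by
  intro h
  have h2 := isUnit_of_mul_isUnit_left h
  exact (PadicInt.prime_p (p := 3)).not_isUnit (by simpa using h2)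

theorem dcC_cover (z : ℤ_[3]) (hz : z ≠ 0) : ∃ k : Fin 9, z ∈ dcC k := by
  have h1 := PadicInt.unitCoeff_spec hz
  have hu := (PadicInt.unitCoeff hz).isUnit
  set u : ℤ_[3] := (PadicInt.unitCoeff hz : ℤ_[3])
  set v := z.valuation
  obtain ⟨m, hm, s, hs⟩ := dc_mod9 u
  have key : ∀ g : ℕ, g < 3 → ((∃ t, u = dcG g + 9 * t) ∨ (∃ t, u = -dcG g + 9 * t)) →
      ∃ k : Fin 9, z ∈ dcC k := by
    intro g hg h
    refine ⟨⟨3 * (v % 3) + g, by omega⟩, Set.mem_iUnion.2 ⟨v / 3, ?_⟩⟩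
    have e1 : (3 * (v % 3) + g) / 3 = v % 3 := by omega
    have e2 : 3 * (v / 3) + v % 3 = v := by omega
    have e3 : dcG (3 * (v % 3) + g) = dcG g := by
      unfold dcG
      rw [show (3 * (v % 3) + g) % 3 = g % 3 by omega]
    simp only [e1, e2, e3]
    rcases h with ⟨t, ht⟩ | ⟨t, ht⟩
    · left
      refine ⟨t, ?_⟩
      rw [h1, ht]; push_cast; ring
    · right
      refine ⟨t, ?_⟩
      rw [h1, ht]; push_cast; ring
  interval_cases m
  · exact absurd hu (by rw [hs]; convert dc_three_not_unit (3 * s) using 2; push_cast; ring)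
  · exact key 0 (by norm_num) (Or.inl ⟨s, by rw [hs]; simp [dcG]⟩)
  · exact key 1 (by norm_num) (Or.inl ⟨s, by rw [hs]; simp [dcG]⟩)
  · exact absurd hu (by rw [hs]; convert dc_three_not_unit (1 + 3 * s) using 2; push_cast; ring)
  · exact key 2 (by norm_num) (Or.inl ⟨s, by rw [hs]; simp [dcG]⟩)
  · exact key 2 (by norm_num) (Or.inr ⟨s + 1, by rw [hs]; simp [dcG]; ring⟩)
  · exact absurd hu (by rw [hs]; convert dc_three_not_unit (2 + 3 * s) using 2; push_cast; ring)
  · exact key 1 (by norm_num) (Or.inr ⟨s + 1, by rw [hs]; simp [dcG]; ring⟩)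
  · exact key 0 (by norm_num) (Or.inr ⟨s + 1, by rw [hs]; simp [dcG]; ring⟩)

theorem dcG_unit (k : ℕ) : ∃ h : ℤ_[3], (dcG k : ℤ_[3]) * h = 1 := by
  have h2 : IsUnit ((2 : ℕ) : ℤ_[3]) := by
    rw [PadicInt.isUnit_iff]
    have := PadicInt.norm_int_lt_one_iff_dvd (p := 3) 2
    have h := PadicInt.norm_le_one (2 : ℤ_[3])
    norm_num at this
    push_cast
    linarith
  have : IsUnit (dcG k : ℤ_[3]) := by
    unfold dcG
    split_ifs
    · simp
    · exact h2
    · have := h2.mul h2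
      norm_num at this ⊢
      exact this
  obtain ⟨h, hh⟩ := this.exists_right_inv
  exact ⟨h, hh⟩

theorem dcC_form (k : ℕ) (z : ℤ_[3]) (hz : z ∈ dcC k) :
    ∃ c : ℚ_[3], c ≠ 0 ∧ (z : ℚ_[3]) = 3 ^ (k / 3) * dcG k * c ^ 3 := by
  obtain ⟨n, hn⟩ := Set.mem_iUnion.1 hz
  obtain ⟨h, hh⟩ := dcG_unit k
  have key : ∃ e : ℤ_[3], e ^ 2 = 1 ∧ ∃ s, z = 3 ^ (3 * n + k / 3) * (e * dcG k + 9 * s) := by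
    rcases hn with ⟨s, hs⟩ | ⟨s, hs⟩
    · exact ⟨1, by ring, s, by linear_combination hs⟩
    · exact ⟨-1, by ring, s, by linear_combination hs⟩
  obtain ⟨e, he, s, hs⟩ := key
  obtain ⟨c, hc⟩ := dc_cube (e * h * s)
  have hz' : z = 3 ^ (k / 3) * dcG k * (3 ^ n * e * c) ^ 3 := by
    have : (3 ^ n * e * c) ^ 3 = 3 ^ (3 * n) * e * (1 + 9 * (e * h * s)) := by
      rw [mul_pow, mul_pow, hc, ← pow_mul, mul_comm n 3]
      linear_combination 3 ^ (3 * n) * e * (1 + 9 * (e * h * s)) * he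
    rw [this, hs, pow_add]
    linear_combination (-3 ^ (3 * n) * 3 ^ (k / 3) * 9 * s) * hh +
      (-3 ^ (3 * n) * 3 ^ (k / 3) * 9 * s * h * dcG k) * he
  have hc0 : c ≠ 0 := by
    rintro rfl
    apply dc_three_not_unit (-3 * (e * h * s))
    have : 3 * (-3 * (e * h * s)) = 1 := by linear_combination hc
    rw [this]; exact isUnit_one
  have he0 : e ≠ 0 := by rintro rfl; simp at he
  refine ⟨((3 ^ n * e * c : ℤ_[3]) : ℚ_[3]), ?_, ?_⟩
  · rw [Ne, PadicInt.coe_eq_zero]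
    have : (3 : ℤ_[3]) ≠ 0 := by norm_num
    positivity
  · conv_lhs => rw [hz']
    push_cast; rfl

theorem dcChk_iff (a b c d : ℕ) : dcChk a b c d = true ↔
    ∃ e ∈ [0, 1, 8], ∃ f ∈ [0, 1, 8], ∃ g ∈ [0, 1, 8],
      9 ∣ dcG a + dcT a b * e + dcT a c * f + dcT a d * g := by
  simp only [dcChk, List.any_eq_true, Nat.beq_eq, Nat.dvd_iff_mod_eq_zero]

/-- coefficient -/
noncomputable def dcA (k : ℕ) : ℚ_[3] := 3 ^ (k / 3) * dcG k

def dcSolv (a b c d : ℚ_[3]) : Prop := ∃ x y z w : ℚ_[3],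
  ¬ (x = 0 ∧ y = 0 ∧ z = 0 ∧ w = 0) ∧ a * x ^ 3 + b * y ^ 3 + c * z ^ 3 + d * w ^ 3 = 0

theorem dc_coe3 : ((3 : ℤ_[3]) : ℚ_[3]) = 3 := rfl

theorem dc_term (a b : ℕ) (ha : a < 9) (hb : b < 9) (e : ℕ) (he : e ∈ [0, 1, 8]) :
    ∃ y : ℚ_[3], ∃ s : ℤ_[3], dcA b * y ^ 3 = 3 ^ (a / 3) * (dcT a b * e + 9 * (s : ℚ_[3])) := by
  have hes : ∃ s : ℕ, e ^ 3 = e + 9 * s := by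
    simp only [List.mem_cons, List.not_mem_nil, or_false] at he
    rcases he with rfl | rfl | rfl
    · exact ⟨0, rfl⟩
    · exact ⟨0, rfl⟩
    · exact ⟨56, rfl⟩
  obtain ⟨s, hs⟩ := hes
  have hs' : (e : ℚ_[3]) ^ 3 = e + 9 * s := by exact_mod_cast hs
  have h1 : a / 3 < 3 := by omega
  have h2 : b / 3 < 3 := by omega
  unfold dcA dcT
  generalize a / 3 = i at *
  generalize b / 3 = j at *
  by_cases hij : i ≤ j
  · refine ⟨e, 3 ^ (j - i) * dcG b * s, ?_⟩
    have : (j + 3 - i) % 3 = j - i := by omega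
    rw [this, hs']
    obtain ⟨m, rfl⟩ := Nat.exists_eq_add_of_le hij
    push_cast [pow_add, dc_coe3]
    simp only [add_tsub_cancel_left]; ring
  · refine ⟨3 * e, 3 ^ (j + 3 - i) * dcG b * s, ?_⟩
    have : (j + 3 - i) % 3 = j + 3 - i := by omega
    rw [this, mul_pow, hs']
    have h3 : (3 : ℚ_[3]) ^ j * 3 ^ 3 = 3 ^ i * 3 ^ (j + 3 - i) := by
      rw [← pow_add, ← pow_add]; congr 1; omega
    push_cast [dc_coe3]
    linear_combination (dcG b * (e + 9 * s) : ℚ_[3]) * h3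

theorem dcSolv_of_chk (a b c d : ℕ) (ha : a < 9) (hb : b < 9) (hc : c < 9) (hd : d < 9)
    (h : dcChk a b c d = true) : dcSolv (dcA a) (dcA b) (dcA c) (dcA d) := by
  rw [dcChk_iff] at h
  obtain ⟨e, he, f, hf, g, hg, n, hn⟩ := h
  obtain ⟨y, s, hy⟩ := dc_term a b ha hb e he
  obtain ⟨z, t, hz⟩ := dc_term a c ha hc f hf
  obtain ⟨w, u, hw⟩ := dc_term a d ha hd g hg
  obtain ⟨h, hh⟩ := dcG_unit a
  obtain ⟨x, hx⟩ := dc_cube (-(h * ((n : ℤ_[3]) + s + t + u)))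
  have hx' := congrArg (fun q : ℤ_[3] => (q : ℚ_[3])) hx
  have hh' := congrArg (fun q : ℤ_[3] => (q : ℚ_[3])) hh
  have hn' := congrArg (fun q : ℕ => (q : ℚ_[3])) hn
  have h9 : ((9 : ℤ_[3]) : ℚ_[3]) = 9 := rfl
  push_cast [h9] at hx' hh' hn'
  refine ⟨x, y, z, w, ?_, ?_⟩
  · rintro ⟨h0, -⟩
    rw [PadicInt.coe_eq_zero] at h0
    subst h0
    have h3 : ‖(9 : ℤ_[3])‖ = 9⁻¹ := by
      rw [show (9 : ℤ_[3]) = (3 : ℕ) ^ 2 by norm_num, norm_pow, PadicInt.norm_p]; norm_num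
    have h4 : (9 : ℤ_[3]) * (h * ((n : ℤ_[3]) + s + t + u)) = 1 := by linear_combination hx
    have h5 := congrArg norm h4
    rw [norm_mul, h3] at h5
    have := PadicInt.norm_le_one (h * ((n : ℤ_[3]) + s + t + u))
    simp only [norm_one] at h5
    linarith
  · rw [hy, hz, hw, hx']
    unfold dcA
    linear_combination (3 : ℚ_[3]) ^ (a / 3) * hn' -
      (3 : ℚ_[3]) ^ (a / 3) * 9 * (n + s + t + u) * hh'

theorem dc_cube_res (y : ℤ_[3]) : ∃ e ∈ [0, 1, 8], ∃ s : ℤ_[3], y ^ 3 = ((e : ℕ) : ℤ_[3]) + 9 * s := by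
  obtain ⟨m, hm, s, rfl⟩ := dc_mod9 y
  refine ⟨m ^ 3 % 9, by interval_cases m <;> decide,
    (m ^ 3 / 9 : ℕ) + 3 * m ^ 2 * s + 27 * m * s ^ 2 + 81 * s ^ 3, ?_⟩
  have h := congrArg (fun q : ℕ => (q : ℤ_[3])) (Nat.mod_add_div (m ^ 3) 9)
  simp only [Nat.cast_add, Nat.cast_mul, Nat.cast_pow, Nat.cast_ofNat] at h
  linear_combination -h

theorem dc_norm_three : ‖(3 : ℚ_[3])‖ = 3⁻¹ := by simpa using Padic.norm_p (p := 3)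

/-- integrality from the norm of the cube -/
theorem dc_norm_le (y : ℚ_[3]) (h : ‖y‖ ^ 3 < 27) : ‖y‖ ≤ 1 := by
  have h3 : ‖y‖ < 3 := by
    by_contra hlt
    push Not at hlt
    have := pow_le_pow_left₀ (by norm_num) hlt 3
    norm_num at this
    linarith
  have := Padic.norm_le_pow_iff_norm_lt_pow_add_one (p := 3) y 0
  norm_num at this
  exact this.2 h3

theorem dc_res (a b : ℕ) (ha : a < 9) (hb : b < 9) (y : ℚ_[3])
    (hy : ‖dcA b * y ^ 3‖ ≤ ‖dcA a‖) :
    ∃ e ∈ [0, 1, 8], ∃ s : ℤ_[3],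
      dcA b * y ^ 3 = 3 ^ (a / 3) * (dcT a b * (e : ℕ) + 9 * (s : ℚ_[3])) := by
  have hG : ∀ k, ‖(dcG k : ℚ_[3])‖ = 1 := by
    intro k
    obtain ⟨h, hh⟩ := dcG_unit k
    have := PadicInt.isUnit_iff.1 (IsUnit.of_mul_eq_one _ hh)
    rw [PadicInt.norm_def] at this
    exact_mod_cast this
  have h1 : a / 3 < 3 := by omega
  have h2 : b / 3 < 3 := by omega
  unfold dcA dcT at *
  simp only [norm_mul, norm_pow, hG, dc_norm_three, mul_one] at hy
  generalize a / 3 = i at *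
  generalize b / 3 = j at *
  have h9 : ((9 : ℤ_[3]) : ℚ_[3]) = 9 := rfl
  have hp := pow_nonneg (norm_nonneg y) 3
  by_cases hij : i ≤ j
  · have hle : ‖y‖ ≤ 1 := by
      apply dc_norm_le
      interval_cases i <;> interval_cases j <;> norm_num at hy hij <;> linarith
    obtain ⟨e, he, s, hs⟩ := dc_cube_res ⟨y, hle⟩
    have hs' : y ^ 3 = ((e : ℤ_[3]) + 9 * s : ℤ_[3]) := congrArg (fun q : ℤ_[3] => (q : ℚ_[3])) hs
    push_cast [h9] at hs'
    refine ⟨e, he, 3 ^ (j - i) * dcG b * s, ?_⟩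
    have : (j + 3 - i) % 3 = j - i := by omega
    rw [this, hs']
    obtain ⟨m, rfl⟩ := Nat.exists_eq_add_of_le hij
    push_cast [pow_add, dc_coe3]
    simp only [add_tsub_cancel_left]; ring
  · have hle : ‖y / 3‖ ≤ 1 := by
      apply dc_norm_le
      rw [norm_div, dc_norm_three, div_pow]
      interval_cases i <;> interval_cases j <;> norm_num at hy hij ⊢ <;> linarith
    obtain ⟨e, he, s, hs⟩ := dc_cube_res ⟨y / 3, hle⟩
    have hs' : (y / 3) ^ 3 = ((e : ℤ_[3]) + 9 * s : ℤ_[3]) := congrArg (fun q : ℤ_[3] => (q : ℚ_[3])) hs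
    push_cast [h9] at hs'
    refine ⟨e, he, 3 ^ (j + 3 - i) * dcG b * s, ?_⟩
    have : (j + 3 - i) % 3 = j + 3 - i := by omega
    have h3 : (3 : ℚ_[3]) ^ j * 3 ^ 3 = 3 ^ i * 3 ^ (j + 3 - i) := by
      rw [← pow_add, ← pow_add]; congr 1; omega
    have hy3 : y ^ 3 = 27 * (e + 9 * s) := by rw [← hs']; ring
    rw [this, hy3]
    push_cast [dc_coe3]
    linear_combination (dcG b * (e + 9 * s) : ℚ_[3]) * h3

theorem dcChk_of_max (a b c d : ℕ) (ha : a < 9) (hb : b < 9) (hc : c < 9) (hd : d < 9)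
    (x y z w : ℚ_[3]) (hx : x ≠ 0)
    (h : dcA a * x ^ 3 + dcA b * y ^ 3 + dcA c * z ^ 3 + dcA d * w ^ 3 = 0)
    (hy : ‖dcA b * y ^ 3‖ ≤ ‖dcA a * x ^ 3‖) (hz : ‖dcA c * z ^ 3‖ ≤ ‖dcA a * x ^ 3‖)
    (hw : ‖dcA d * w ^ 3‖ ≤ ‖dcA a * x ^ 3‖) : dcChk a b c d = true := by
  have hsc : ∀ k (q : ℚ_[3]), ‖dcA k * q ^ 3‖ ≤ ‖dcA a * x ^ 3‖ →
      ‖dcA k * (q / x) ^ 3‖ ≤ ‖dcA a‖ := by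
    intro k q hq
    have : dcA k * (q / x) ^ 3 = dcA k * q ^ 3 / x ^ 3 := by rw [div_pow]; ring
    rw [this, norm_div, div_le_iff₀ (norm_pos_iff.2 (pow_ne_zero 3 hx)), ← norm_mul]
    exact hq
  rw [dcChk_iff]
  obtain ⟨e, he, s, hs⟩ := dc_res a b ha hb _ (hsc b y hy)
  obtain ⟨f, hf, t, ht⟩ := dc_res a c ha hc _ (hsc c z hz)
  obtain ⟨g, hg, u, hu⟩ := dc_res a d ha hd _ (hsc d w hw)
  refine ⟨e, he, f, hf, g, hg, ?_⟩
  have h1 : dcA a + dcA b * (y / x) ^ 3 + dcA c * (z / x) ^ 3 + dcA d * (w / x) ^ 3 = 0 := by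
    field_simp
    rw [h, mul_zero]
  rw [hs, ht, hu, dcA] at h1
  have h2 : (3 : ℚ_[3]) ^ (a / 3) * (dcG a + dcT a b * e + dcT a c * f + dcT a d * g
      + 9 * (s + t + u)) = 0 := by linear_combination h1
  have h3 : ((dcG a + dcT a b * e + dcT a c * f + dcT a d * g + 9 * (s + t + u) : ℤ_[3]) : ℚ_[3])
      = 0 := by
    have h9 : ((9 : ℤ_[3]) : ℚ_[3]) = 9 := rfl
    push_cast [h9]
    exact (mul_eq_zero.1 h2).resolve_left (pow_ne_zero _ (by norm_num))
  rw [PadicInt.coe_eq_zero] at h3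
  have h4 := (PadicInt.pow_p_dvd_int_iff (p := 3) 2
    ((dcG a + dcT a b * e + dcT a c * f + dcT a d * g : ℕ) : ℤ)).1
    ⟨-(s + t + u), by push_cast; linear_combination h3⟩
  exact_mod_cast h4

theorem dcA_ne (k : ℕ) : dcA k ≠ 0 := by
  unfold dcA dcG
  split_ifs <;> norm_num

theorem dcSol_iff (a b c d : ℕ) (ha : a < 9) (hb : b < 9) (hc : c < 9) (hd : d < 9) :
    dcSol a b c d = true ↔ dcSolv (dcA a) (dcA b) (dcA c) (dcA d) := by
  simp only [dcSol, Bool.or_eq_true]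
  constructor
  · rintro (((h | h) | h) | h)
    · exact dcSolv_of_chk _ _ _ _ ha hb hc hd h
    · obtain ⟨x, y, z, w, h0, h⟩ := dcSolv_of_chk _ _ _ _ hb ha hc hd h
      exact ⟨y, x, z, w, by tauto, by linear_combination h⟩
    · obtain ⟨x, y, z, w, h0, h⟩ := dcSolv_of_chk _ _ _ _ hc ha hb hd h
      exact ⟨y, z, x, w, by tauto, by linear_combination h⟩
    · obtain ⟨x, y, z, w, h0, h⟩ := dcSolv_of_chk _ _ _ _ hd ha hb hc h
      exact ⟨y, z, w, x, by tauto, by linear_combination h⟩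
  · rintro ⟨x, y, z, w, h0, h⟩
    have nz : ∀ k (q : ℚ_[3]), ‖dcA k * q ^ 3‖ ≤ 0 → q = 0 := by
      intro k q hq
      have := norm_le_zero_iff.1 hq
      simpa [dcA_ne] using this
    have key : ∀ (k k1 k2 k3 : ℕ) (q q1 q2 q3 : ℚ_[3]),
        ‖dcA k1 * q1 ^ 3‖ ≤ ‖dcA k * q ^ 3‖ → ‖dcA k2 * q2 ^ 3‖ ≤ ‖dcA k * q ^ 3‖ →
        ‖dcA k3 * q3 ^ 3‖ ≤ ‖dcA k * q ^ 3‖ → ¬ (q = 0 ∧ q1 = 0 ∧ q2 = 0 ∧ q3 = 0) → q ≠ 0 := by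
      rintro k k1 k2 k3 q q1 q2 q3 h1 h2 h3 h0 rfl
      simp only [ne_eq, OfNat.ofNat_ne_zero, not_false_eq_true, zero_pow, mul_zero, norm_zero]
        at h1 h2 h3
      exact h0 ⟨rfl, nz _ _ h1, nz _ _ h2, nz _ _ h3⟩
    obtain ⟨i, hi⟩ := Finite.exists_max
      ![‖dcA a * x ^ 3‖, ‖dcA b * y ^ 3‖, ‖dcA c * z ^ 3‖, ‖dcA d * w ^ 3‖]
    have e0 := hi 0
    have e1 := hi 1
    have e2 := hi 2
    have e3 := hi 3
    fin_cases i <;> simp at e0 e1 e2 e3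
    · refine Or.inl (Or.inl (Or.inl (dcChk_of_max a b c d ha hb hc hd x y z w ?_ h ?_ ?_ ?_)))
      · exact key a b c d x y z w (by simpa) (by simpa) (by simpa) h0
      all_goals simpa
    · refine Or.inl (Or.inl (Or.inr (dcChk_of_max b a c d hb ha hc hd y x z w ?_
        (by linear_combination h) ?_ ?_ ?_)))
      · exact key b a c d y x z w (by simpa) (by simpa) (by simpa) (by tauto)
      all_goals simpa
    · refine Or.inl (Or.inr (dcChk_of_max c a b d hc ha hb hd z x y w ?_
        (by linear_combination h) ?_ ?_ ?_))
      · exact key c a b d z x y w (by simpa) (by simpa) (by simpa) (by tauto)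
      all_goals simpa
    · refine Or.inr (dcChk_of_max d a b c hd ha hb hc w x y z ?_
        (by linear_combination h) ?_ ?_ ?_)
      · exact key d a b c w x y z (by simpa) (by simpa) (by simpa) (by tauto)
      all_goals simpa

/-! Versions of the definitions with bare `Nat` operations, for quick kernel evaluation. -/

/-- explicit nine-term sum over the literals `0, …, 8` -/
def dcL (f : ℕ → ℕ) : ℕ :=
  Nat.add (f 0) (Nat.add (f 1) (Nat.add (f 2) (Nat.add (f 3) (Nat.add (f 4)
    (Nat.add (f 5) (Nat.add (f 6) (Nat.add (f 7) (f 8))))))))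

theorem dcL_eq (f : ℕ → ℕ) : ∑ a : Fin 9, f a = dcL f := by
  simp [Fin.sum_univ_succ, dcL, Fin.val_succ]

def dcWf (k : ℕ) : ℕ := Nat.pow 3 (Nat.sub 2 (Nat.div k 3))

def dcGf (k : ℕ) : ℕ := Nat.pow 2 (Nat.mod k 3)

def dcTf (i j : ℕ) : ℕ :=
  Nat.mul (Nat.pow 3 (Nat.mod (Nat.sub (Nat.add (Nat.div j 3) 3) (Nat.div i 3)) 3)) (dcGf j)

def dcAny (f : ℕ → Bool) : Bool := cond (f 0) true (cond (f 1) true (f 8))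

def dcChkF (a b c d : ℕ) : Bool :=
  dcAny fun e => dcAny fun f => dcAny fun g =>
    Nat.beq (Nat.mod (Nat.add (Nat.add (Nat.add (dcGf a) (Nat.mul (dcTf a b) e))
      (Nat.mul (dcTf a c) f)) (Nat.mul (dcTf a d) g)) 9) 0

def dcSolF (a b c d : ℕ) : Bool :=
  cond (dcChkF a b c d) true
    (cond (dcChkF b a c d) true (cond (dcChkF c a b d) true (dcChkF d a b c)))

theorem dcGf_eq (k : ℕ) : dcGf k = dcG k := by
  change 2 ^ (k % 3) = dcG k
  unfold dcG
  have : k % 3 < 3 := Nat.mod_lt _ (by norm_num)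
  interval_cases k % 3 <;> rfl

theorem dcTf_eq (i j : ℕ) : dcTf i j = dcT i j := by
  change 3 ^ ((j / 3 + 3 - i / 3) % 3) * dcGf j = _
  rw [dcGf_eq, dcT]

theorem dcAny_eq (f : ℕ → Bool) : dcAny f = [0, 1, 8].any f := by
  simp [dcAny]

theorem dcChkF_eq (a b c d : ℕ) : dcChkF a b c d = dcChk a b c d := by
  simp only [dcChkF, dcChk, dcAny_eq, dcGf_eq, dcTf_eq]
  rfl

theorem dcSolF_eq (a b c d : ℕ) : dcSolF a b c d = dcSol a b c d := by
  simp only [dcSolF, dcSol, dcChkF_eq, Bool.cond_true_left, Bool.or_assoc]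

theorem dcL_sol : Nat.beq (dcL fun a => dcL fun b => dcL fun c => dcL fun d =>
    cond (dcSolF a b c d) (Nat.mul (Nat.mul (Nat.mul (dcWf a) (dcWf b)) (dcWf c)) (dcWf d)) 0)
      2243241 = true := by
  decide +kernel

theorem dc_sum : (∑ a : Fin 9, ∑ b : Fin 9, ∑ c : Fin 9, ∑ d : Fin 9,
    if dcSol a b c d = true then dcW a * dcW b * dcW c * dcW d else 0) = 2243241 := by
  rw [← Nat.eq_of_beq_eq_true dcL_sol, ← dcL_eq]
  refine Finset.sum_congr rfl fun a _ => ?_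
  rw [← dcL_eq]
  refine Finset.sum_congr rfl fun b _ => ?_
  rw [← dcL_eq]
  refine Finset.sum_congr rfl fun c _ => ?_
  rw [← dcL_eq]
  refine Finset.sum_congr rfl fun d _ => ?_
  rw [dcSolF_eq]
  cases dcSol a b c d <;> rfl

theorem dc_sum_all : (∑ a : Fin 9, ∑ b : Fin 9, ∑ c : Fin 9, ∑ d : Fin 9,
    dcW a * dcW b * dcW c * dcW d) = 2313441 := by
  have h : ∑ d : Fin 9, dcW d = 39 := by decide
  simp only [← Finset.mul_sum, ← Finset.sum_mul, h]
  norm_num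

/-- box of four classes -/
def dcBox (k : Fin 9 × Fin 9 × Fin 9 × Fin 9) : Set (Fin 4 → ℤ_[3]) :=
  Set.univ.pi ![dcC k.1, dcC k.2.1, dcC k.2.2.1, dcC k.2.2.2]

/-- weight of a box -/
def dcWt (k : Fin 9 × Fin 9 × Fin 9 × Fin 9) : ℕ :=
  dcW k.1 * dcW k.2.1 * dcW k.2.2.1 * dcW k.2.2.2

theorem dcBox_measure (ν : Measure ℤ_[3]) [ν.IsAddHaarMeasure] (hν : ν Set.univ = 1)
    [SigmaFinite ν] (k : Fin 9 × Fin 9 × Fin 9 × Fin 9) :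
    Measure.pi (fun _ : Fin 4 => ν) (dcBox k) ≤ ENNReal.ofReal (dcWt k / 39 ^ 4) := by
  rw [dcBox, Measure.pi_pi, Fin.prod_univ_four]
  have e : (dcWt k / 39 ^ 4 : ℝ) = (dcW k.1 / 39) * (dcW k.2.1 / 39) * (dcW k.2.2.1 / 39)
      * (dcW k.2.2.2 / 39) := by
    simp only [dcWt]; push_cast; ring
  rw [e, ENNReal.ofReal_mul (by positivity), ENNReal.ofReal_mul (by positivity),
    ENNReal.ofReal_mul (by positivity)]
  exact mul_le_mul' (mul_le_mul' (mul_le_mul' (dcC_measure ν hν _ k.1.2)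
    (dcC_measure ν hν _ k.2.1.2)) (dcC_measure ν hν _ k.2.2.1.2)) (dcC_measure ν hν _ k.2.2.2.2)

/-- solvable index -/
def dcSolK (k : Fin 9 × Fin 9 × Fin 9 × Fin 9) : Prop :=
  dcSol k.1 k.2.1 k.2.2.1 k.2.2.2 = true

instance : DecidablePred dcSolK := fun _ => inferInstanceAs (Decidable (_ = true))

theorem dc_sumK : ∑ k with dcSolK k, dcWt k = 2243241 := by
  rw [Finset.sum_filter, ← dc_sum]
  simp only [Fintype.sum_prod_type]
  refine Finset.sum_congr rfl fun a _ => Finset.sum_congr rfl fun b _ =>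
    Finset.sum_congr rfl fun c _ => Finset.sum_congr rfl fun d _ => ?_
  exact if_congr Iff.rfl rfl rfl

theorem dc_sumK_all : ∑ k, dcWt k = 2313441 := by
  rw [← dc_sum_all]
  simp only [Fintype.sum_prod_type, dcWt]

theorem dc_sub_aux (x y z : ℕ) (h : x + y = z) (hx : x = 2243241) (hz : z = 2313441) :
    y = 70200 := by omega

theorem dc_sumK_not : ∑ k with ¬ dcSolK k, dcWt k = 70200 :=
  dc_sub_aux _ _ _ (Finset.sum_filter_add_sum_filter_not Finset.univ dcSolK dcWt)
    dc_sumK dc_sumK_all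

/-- the solvable set -/
def dcS : Set (Fin 4 → ℤ_[3]) := {a : Fin 4 → ℤ_[3] | ∃ x : Fin 4 → ℚ_[3], x ≠ 0 ∧
        (a 0 : ℚ_[3]) * x 0 ^ 3 + (a 1 : ℚ_[3]) * x 1 ^ 3 + (a 2 : ℚ_[3]) * x 2 ^ 3
          + (a 3 : ℚ_[3]) * x 3 ^ 3 = 0}

theorem dcS_iff (a : Fin 4 → ℤ_[3]) : a ∈ dcS ↔ dcSolv (a 0) (a 1) (a 2) (a 3) := by
  constructor
  · rintro ⟨x, hx, h⟩
    refine ⟨x 0, x 1, x 2, x 3, ?_, h⟩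
    rintro ⟨h0, h1, h2, h3⟩
    apply hx
    ext i
    fin_cases i <;> simpa
  · rintro ⟨x, y, z, w, h0, h⟩
    refine ⟨![x, y, z, w], ?_, by simpa using h⟩
    intro h1
    exact h0 ⟨by simpa using congrFun h1 0, by simpa using congrFun h1 1,
      by simpa using congrFun h1 2, by simpa using congrFun h1 3⟩

theorem dcSolv_scale (a b c d p q r s : ℚ_[3]) (hp : p ≠ 0) (hq : q ≠ 0) (hr : r ≠ 0)
    (hs : s ≠ 0) :
    dcSolv (a * p ^ 3) (b * q ^ 3) (c * r ^ 3) (d * s ^ 3) ↔ dcSolv a b c d := by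
  constructor
  · rintro ⟨x, y, z, w, h0, h⟩
    refine ⟨p * x, q * y, r * z, s * w, ?_, by linear_combination h⟩
    simpa [hp, hq, hr, hs] using h0
  · rintro ⟨x, y, z, w, h0, h⟩
    refine ⟨x / p, y / q, z / r, w / s, ?_, ?_⟩
    · simpa [hp, hq, hr, hs] using h0
    · rw [← h]; field_simp

theorem dcS_box (k : Fin 9 × Fin 9 × Fin 9 × Fin 9) (a : Fin 4 → ℤ_[3]) (ha : a ∈ dcBox k) :
    a ∈ dcS ↔ dcSolK k := by
  rw [dcS_iff]
  obtain ⟨p, hp, h0⟩ := dcC_form _ _ (ha 0 trivial)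
  obtain ⟨q, hq, h1⟩ := dcC_form _ _ (ha 1 trivial)
  obtain ⟨r, hr, h2⟩ := dcC_form _ _ (ha 2 trivial)
  obtain ⟨s, hs, h3⟩ := dcC_form _ _ (ha 3 trivial)
  rw [h0, h1, h2, h3, dcSolv_scale _ _ _ _ p q r s hp hq hr hs, dcSolK,
    dcSol_iff _ _ _ _ k.1.2 k.2.1.2 k.2.2.1.2 k.2.2.2.2]
  rfl

theorem dc_cover (a : Fin 4 → ℤ_[3]) (ha : ∀ i, a i ≠ 0) : ∃ k, a ∈ dcBox k := by
  obtain ⟨k0, h0⟩ := dcC_cover _ (ha 0)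
  obtain ⟨k1, h1⟩ := dcC_cover _ (ha 1)
  obtain ⟨k2, h2⟩ := dcC_cover _ (ha 2)
  obtain ⟨k3, h3⟩ := dcC_cover _ (ha 3)
  refine ⟨(k0, k1, k2, k3), ?_⟩
  intro i _
  fin_cases i
  · exact h0
  · exact h1
  · exact h2
  · exact h3

theorem dc_zero_mem (a : Fin 4 → ℤ_[3]) (i : Fin 4) (ha : a i = 0) : a ∈ dcS := by
  refine ⟨Pi.single i 1, by simp, ?_⟩
  have := Fin.sum_univ_four
    (fun j : Fin 4 => (a j : ℚ_[3]) * (Pi.single i 1 : Fin 4 → ℚ_[3]) j ^ 3)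
  rw [← this]
  refine Finset.sum_eq_zero fun j _ => ?_
  by_cases hj : j = i
  · subst hj; simp [ha]
  · simp [hj]

theorem dc_bound (ν : Measure ℤ_[3]) [ν.IsAddHaarMeasure] (hν : ν Set.univ = 1)
    [SigmaFinite ν] (P : Fin 9 × Fin 9 × Fin 9 × Fin 9 → Prop) [DecidablePred P] :
    Measure.pi (fun _ : Fin 4 => ν) (⋃ k ∈ Finset.univ.filter P, dcBox k) ≤
      ENNReal.ofReal ((∑ k with P k, dcWt k : ℕ) / 39 ^ 4) := by
  refine (measure_biUnion_finset_le _ _).trans ?_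
  refine (Finset.sum_le_sum fun k _ => dcBox_measure ν hν k).trans ?_
  rw [← ENNReal.ofReal_sum_of_nonneg (fun _ _ => by positivity)]
  rw [← Finset.sum_div]
  push_cast
  exact le_rfl

theorem dc_main (ν : Measure ℤ_[3]) [ν.IsAddHaarMeasure] (hν : ν Set.univ = 1)
    [SigmaFinite ν] [IsProbabilityMeasure ν] :
    (Measure.pi (fun _ : Fin 4 => ν) dcS).toReal = 2243241 / 39 ^ 4 := by
  set m := Measure.pi (fun _ : Fin 4 => ν) with hm
  have hsing : ν {0} = 0 := by
    have h : ∀ k : ℕ, ν {0} ≤ (3⁻¹ : ENNReal) ^ k := fun k => by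
      rw [← ENNReal.inv_pow, ← dcB_measure ν hν 0 k]
      refine measure_mono ?_
      rintro z rfl
      simp [dcB]
    have hl := ENNReal.tendsto_pow_atTop_nhds_zero_of_lt_one
      (r := (3⁻¹ : ENNReal)) (by rw [ENNReal.inv_lt_one]; norm_num)
    exact le_antisymm (ge_of_tendsto' hl h) zero_le
  have hplane : ∀ i : Fin 4, m {a | a i = 0} = 0 := by
    intro i
    have : {a : Fin 4 → ℤ_[3] | a i = 0} = Function.eval i ⁻¹' {0} := rfl
    rw [this]
    exact Measure.pi_eval_preimage_null _ hsing
  have hnull : m (⋃ i : Fin 4, {a | a i = 0}) = 0 := measure_iUnion_null hplane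
  have up1 : m dcS ≤ ENNReal.ofReal (2243241 / 39 ^ 4) := by
    have hsub : dcS ⊆ (⋃ k ∈ Finset.univ.filter dcSolK, dcBox k) ∪ ⋃ i : Fin 4, {a | a i = 0} := by
      intro a ha
      by_cases h : ∀ i, a i ≠ 0
      · obtain ⟨k, hk⟩ := dc_cover a h
        left
        simp only [Set.mem_iUnion]
        exact ⟨k, by simpa using (dcS_box k a hk).1 ha, hk⟩
      · right
        push Not at h
        exact Set.mem_iUnion.2 h
    refine (measure_mono hsub).trans ((measure_union_le _ _).trans ?_)
    rw [hnull, add_zero]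
    refine (dc_bound ν hν dcSolK).trans ?_
    rw [dc_sumK]; norm_num
  have up2 : m dcSᶜ ≤ ENNReal.ofReal (70200 / 39 ^ 4) := by
    have hsub : dcSᶜ ⊆ (⋃ k ∈ Finset.univ.filter (fun k => ¬ dcSolK k), dcBox k) := by
      intro a ha
      obtain ⟨k, hk⟩ := dc_cover a (fun i hi => ha (dc_zero_mem a i hi))
      simp only [Set.mem_iUnion]
      exact ⟨k, by simpa using fun h => ha ((dcS_box k a hk).2 h), hk⟩
    refine (measure_mono hsub).trans ?_
    refine (dc_bound ν hν (fun k => ¬ dcSolK k)).trans ?_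
    rw [dc_sumK_not]; norm_num
  have htot : 1 ≤ (m dcS).toReal + (m dcSᶜ).toReal := by
    have h := measure_union_le (μ := m) dcS dcSᶜ
    rw [Set.union_compl_self, measure_univ] at h
    rw [← ENNReal.toReal_add (measure_ne_top _ _) (measure_ne_top _ _)]
    simpa using ENNReal.toReal_mono (by simp [measure_ne_top]) h
  have r1 := ENNReal.toReal_mono ENNReal.ofReal_ne_top up1
  have r2 := ENNReal.toReal_mono ENNReal.ofReal_ne_top up2
  rw [ENNReal.toReal_ofReal (by norm_num)] at r1 r2
  norm_num at r1 r2 ⊢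
  linarith

/-- For `p = 3`, the density of coefficient vectors `a ∈ ℤ₃⁴` for which the diagonal cubic
surface `S_a : a₀x₀³ + a₁x₁³ + a₂x₂³ + a₃x₃³ = 0` has a `ℚ₃`-point equals
`[(1 − 1/3)³/(1 − 1/3³)³] · (1 + 3/3 + 46/(9·3²) + 7/3³ + 62/(9·3⁴) + 19/(9·3⁵) + 1/3⁶)`,
where `μ` is the Haar measure on `ℤ₃⁴` normalized so that `μ(ℤ₃⁴) = 1`. -/
theorem density_diagonal_cubic_solvable_at_three
    (μ : Measure (Fin 4 → ℤ_[3])) [μ.IsAddHaarMeasure] (hμ : μ Set.univ = 1) :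
    (μ {a : Fin 4 → ℤ_[3] | ∃ x : Fin 4 → ℚ_[3], x ≠ 0 ∧
        (a 0 : ℚ_[3]) * x 0 ^ 3 + (a 1 : ℚ_[3]) * x 1 ^ 3 + (a 2 : ℚ_[3]) * x 2 ^ 3
          + (a 3 : ℚ_[3]) * x 3 ^ 3 = 0}).toReal
      = ((1 - 1 / (3 : ℝ)) ^ 3 / (1 - 1 / (3 : ℝ) ^ 3) ^ 3)
        * (1 + 3 / (3 : ℝ) + 46 / (9 * (3 : ℝ) ^ 2) + 7 / (3 : ℝ) ^ 3
            + 62 / (9 * (3 : ℝ) ^ 4) + 19 / (9 * (3 : ℝ) ^ 5) + 1 / (3 : ℝ) ^ 6) := by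
  have : IsProbabilityMeasure μ := ⟨hμ⟩
  let ν : Measure ℤ_[3] := Measure.addHaarMeasure ⊤
  have hν : ν Set.univ = 1 := by
    simpa using Measure.addHaarMeasure_self (K₀ := (⊤ : TopologicalSpace.PositiveCompacts ℤ_[3]))
  have hp : IsProbabilityMeasure ν := ⟨hν⟩
  have hμν : μ = Measure.pi (fun _ : Fin 4 => ν) :=
    Measure.isAddHaarMeasure_eq_of_isProbabilityMeasure _ _
  have h := dc_main ν hν
  rw [← hμν] at h
  refine Eq.trans h ?_
  norm_num
end

section
/- Let p be a prime with p ≡ 1 (mod 3). Then μ_p({a ∈ ℤ_p⁴ : v(a) = (0,0,1,1) and S_a(ℚ_p) ≠ ∅}) = (5/9) · μ_p({a ∈ ℤ_p⁴ : v(a) = (0,0,1,1)}). -/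
open MeasureTheory

namespace DiagCubic

variable {p : ℕ} [Fact p.Prime]

lemma toZMod_eq_zero_iff (x : ℤ_[p]) : PadicInt.toZMod x = 0 ↔ ‖x‖ < 1 := by
  rw [← RingHom.mem_ker, PadicInt.ker_toZMod, IsLocalRing.mem_maximalIdeal, PadicInt.mem_nonunits]

lemma norm_three (hp : p % 3 = 1) : ‖(3 : ℤ_[p])‖ = 1 := by
  have h1 : ¬ ‖((3 : ℤ) : ℤ_[p])‖ < 1 := by
    rw [PadicInt.norm_int_lt_one_iff_dvd]
    intro h
    have h2 : p ∣ 3 := by exact_mod_cast h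
    have h3 := (Nat.prime_dvd_prime_iff_eq (Fact.out : p.Prime) Nat.prime_three).1 h2
    subst h3
    simp at hp
  have h2 := PadicInt.norm_le_one (3 : ℤ_[p])
  push_cast at h1
  exact le_antisymm h2 (not_lt.1 h1)

/-- Hensel: a `p`-adic integer congruent to `1` is a cube of a unit. -/
lemma cube_of_near_one (hp : p % 3 = 1) (u : ℤ_[p]) (hu : ‖u - 1‖ < 1) :
    ∃ c : ℤ_[p]ˣ, u = (c : ℤ_[p]) ^ 3 := by
  have h := hensels_lemma (p := p) (R := ℤ_[p]) (F := Polynomial.X ^ 3 - Polynomial.C u) (a := 1)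
    (by
      have h3 : (2 + 1 : ℤ_[p]) = 3 := by norm_num
      simp [Polynomial.aeval_def, h3, norm_three hp]
      rw [← norm_neg]; simpa using hu)
  obtain ⟨z, hz, hz1, -⟩ := h
  have hz0 : u = z ^ 3 := by
    simp [Polynomial.aeval_def] at hz
    exact (sub_eq_zero.1 hz).symm
  have hz2 : ‖z‖ = 1 := by
    have h1 : ‖z - 1‖ < 1 := by
      have h3 : (2 + 1 : ℤ_[p]) = 3 := by norm_num
      simpa [Polynomial.aeval_def, h3, norm_three hp] using hz1
    by_contra hne
    have h2 : ‖z‖ < 1 := lt_of_le_of_ne (PadicInt.norm_le_one z) hne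
    rw [← toZMod_eq_zero_iff] at h1 h2
    simp [h2] at h1
  obtain ⟨c, hc⟩ := PadicInt.isUnit_iff.2 hz2
  exact ⟨c, by rw [hc, hz0]⟩

/-- The reduction map on units. -/
noncomputable def red : ℤ_[p]ˣ →* (ZMod p)ˣ :=
  Units.map (PadicInt.toZMod (p := p)).toMonoidHom

lemma red_surj : Function.Surjective (red (p := p)) := by
  intro v
  obtain ⟨x, hx⟩ := ZMod.ringHom_surjective (PadicInt.toZMod (p := p)) (v : ZMod p)
  have hx1 : ‖x‖ = 1 := by
    by_contra hne
    have h2 : ‖x‖ < 1 := lt_of_le_of_ne (PadicInt.norm_le_one x) hne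
    rw [← toZMod_eq_zero_iff, hx] at h2
    exact v.ne_zero h2
  obtain ⟨c, hc⟩ := PadicInt.isUnit_iff.2 hx1
  refine ⟨c, Units.ext ?_⟩
  simp [red, hc, hx]

lemma cube_of_red_one (hp : p % 3 = 1) (u : ℤ_[p]ˣ) (hu : red u = 1) :
    ∃ c : ℤ_[p]ˣ, u = c ^ 3 := by
  have h : ‖(u : ℤ_[p]) - 1‖ < 1 := by
    rw [← toZMod_eq_zero_iff]
    have := congrArg Units.val hu
    simp [red] at this
    simp [this]
  obtain ⟨c, hc⟩ := cube_of_near_one hp _ h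
  exact ⟨c, Units.ext (by simpa using hc)⟩

/-- Units modulo cubes form a cyclic group of order three. -/
lemma exists_gen (hp : p % 3 = 1) : ∃ g : ℤ_[p]ˣ,
    (∀ u : ℤ_[p]ˣ, ∃ i : Fin 3, ∃ c : ℤ_[p]ˣ, u = g ^ (i : ℕ) * c ^ 3) ∧
    ∀ (i j : Fin 3) (c d : ℤ_[p]ˣ), g ^ (i : ℕ) * c ^ 3 = g ^ (j : ℕ) * d ^ 3 → i = j := by
  obtain ⟨ζ, hζ⟩ := IsCyclic.exists_generator (α := (ZMod p)ˣ)
  obtain ⟨g, hg⟩ := red_surj ζ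
  have hord : orderOf ζ = p - 1 := by
    rw [orderOf_eq_card_of_forall_mem_zpowers hζ, Nat.card_eq_fintype_card, ZMod.card_units]
  refine ⟨g, ?_, ?_⟩
  · intro u
    obtain ⟨k, hk⟩ := Subgroup.mem_zpowers_iff.1 (hζ (red u))
    obtain ⟨c, hc⟩ := cube_of_red_one hp (u * (g ^ k)⁻¹) (by simp [hg, hk])
    have hk0 : 0 ≤ k % 3 := Int.emod_nonneg _ (by norm_num)
    have hk3 : k % 3 < 3 := Int.emod_lt_of_pos _ (by norm_num)
    refine ⟨⟨(k % 3).toNat, by omega⟩, g ^ (k / 3) * c, ?_⟩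
    have h1 : g ^ (k % 3).toNat = g ^ (k % 3) := by
      rw [← zpow_natCast, Int.toNat_of_nonneg hk0]
    have h2 : u = c ^ 3 * g ^ k := by rw [← hc]; group
    have h3 : g ^ k = g ^ (k % 3) * (g ^ (k / 3)) ^ 3 := by
      rw [← zpow_natCast (g ^ (k / 3)), ← zpow_mul, ← zpow_add]
      congr 1
      push_cast
      omega
    simp only [h1, mul_pow]
    rw [h2, h3, mul_comm, mul_assoc]
  · intro i j c d h
    have h1 := congrArg red h
    simp only [map_mul, map_pow, hg] at h1
    obtain ⟨m, hm⟩ := Subgroup.mem_zpowers_iff.1 (hζ (red c))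
    obtain ⟨n, hn⟩ := Subgroup.mem_zpowers_iff.1 (hζ (red d))
    rw [← hm, ← hn] at h1
    have h2 : ζ ^ (((i : ℕ) : ℤ) + m * 3 - (((j : ℕ) : ℤ) + n * 3)) = 1 := by
      rw [zpow_sub, zpow_add, zpow_add, zpow_mul, zpow_mul, zpow_natCast, zpow_natCast,
        mul_inv_eq_one]
      exact_mod_cast h1
    rw [← orderOf_dvd_iff_zpow_eq_one, hord] at h2
    have h3 : (3 : ℤ) ∣ ((p - 1 : ℕ) : ℤ) := by omega
    have h4 := h3.trans h2
    ext
    omega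

lemma norm_unit (c : ℤ_[p]ˣ) : ‖((c : ℤ_[p]) : ℚ_[p])‖ = 1 := by
  rw [← PadicInt.norm_def]; exact PadicInt.isUnit_iff.1 c.isUnit

lemma unit_of_norm (z : ℚ_[p]) (hz : ‖z‖ = 1) : ∃ c : ℤ_[p]ˣ, ((c : ℤ_[p]) : ℚ_[p]) = z := by
  obtain ⟨c, hc⟩ := PadicInt.isUnit_iff.2 
    (show ‖(id ⟨z, hz.le⟩ : ℤ_[p])‖ = 1 from hz)
  exact ⟨c, by rw [hc]; rfl⟩

lemma unit_ratio (x y : ℤ_[p]) (hy : y ≠ 0) (h : ‖x‖ = ‖y‖) : ∃ u : ℤ_[p]ˣ, x = u * y := by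
  have hy' : (y : ℚ_[p]) ≠ 0 := fun h => hy (Subtype.ext h)
  obtain ⟨c, hc⟩ := unit_of_norm ((x : ℚ_[p]) / (y : ℚ_[p])) (by
    rw [norm_div, ← PadicInt.norm_def, ← PadicInt.norm_def, h, div_self (norm_ne_zero_iff.2 hy)])
  refine ⟨c, ?_⟩
  have : (x : ℚ_[p]) = ((c * y : ℤ_[p]) : ℚ_[p]) := by
    push_cast
    rw [hc, div_mul_cancel₀ _ hy']
  exact Subtype.ext this

/-- If `u` is not a cube, then `x³ + u y³` has the norm of a nonzero cube. -/
lemma cubic_norm (hp : p % 3 = 1) (u : ℤ_[p]ˣ) (hu : ¬ ∃ c : ℤ_[p]ˣ, u = c ^ 3) (x y : ℚ_[p])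
    (hxy : ¬ (x = 0 ∧ y = 0)) :
    ∃ w : ℚ_[p], w ≠ 0 ∧ ‖x ^ 3 + ((u : ℤ_[p]) : ℚ_[p]) * y ^ 3‖ = ‖w‖ ^ 3 := by
  by_cases hn : ‖x‖ = ‖y‖
  · have hy : y ≠ 0 := by
      rintro rfl
      simp at hn
      exact hxy ⟨hn, rfl⟩
    refine ⟨y, hy, ?_⟩
    obtain ⟨z, hz⟩ := unit_of_norm (-x / y) (by
      rw [norm_div, norm_neg, hn, div_self (norm_ne_zero_iff.2 hy)])
    have hx : x = -((z : ℤ_[p]) : ℚ_[p]) * y := by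
      rw [hz]; field_simp
    have h1 : ¬ ‖((u * (z ^ 3)⁻¹ : ℤ_[p]ˣ) : ℤ_[p]) - 1‖ < 1 := by
      intro h
      obtain ⟨c, hc⟩ := cube_of_near_one hp _ h
      have hc' : u * (z ^ 3)⁻¹ = c ^ 3 := Units.ext (by simpa using hc)
      exact hu ⟨c * z, by rw [mul_pow, ← hc']; group⟩
    have h2 : ‖((u * (z ^ 3)⁻¹ : ℤ_[p]ˣ) : ℤ_[p]) - 1‖ = 1 :=
      le_antisymm (PadicInt.norm_le_one _) (not_lt.1 h1)
    have h3 : (u : ℤ_[p]) - z ^ 3 = (((u * (z ^ 3)⁻¹ : ℤ_[p]ˣ) : ℤ_[p]) - 1) * (z : ℤ_[p]) ^ 3 := by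
      have : (u : ℤ_[p]) = ((u * (z ^ 3)⁻¹ : ℤ_[p]ˣ) : ℤ_[p]) * (z : ℤ_[p]) ^ 3 := by
        rw [← Units.val_pow_eq_pow_val, ← Units.val_mul]; congr 1; group
      rw [sub_mul, one_mul, ← this]
    have h4 : ‖(u : ℤ_[p]) - z ^ 3‖ = 1 := by
      rw [h3, norm_mul, h2, norm_pow, PadicInt.isUnit_iff.1 z.isUnit]; norm_num
    have h5 : x ^ 3 + ((u : ℤ_[p]) : ℚ_[p]) * y ^ 3
        = (((u : ℤ_[p]) - z ^ 3 : ℤ_[p]) : ℚ_[p]) * y ^ 3 := by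
      push_cast
      rw [hx]; ring
    rw [h5, norm_mul, ← PadicInt.norm_def, h4, one_mul, norm_pow]
  · have h1 : ‖x ^ 3‖ ≠ ‖((u : ℤ_[p]) : ℚ_[p]) * y ^ 3‖ := by
      rw [norm_mul, norm_unit, one_mul, norm_pow, norm_pow]
      intro h
      exact hn ((pow_left_inj₀ (norm_nonneg _) (norm_nonneg _) (by norm_num)).1 h)
    rw [Padic.add_eq_max_of_ne h1, norm_mul, norm_unit, one_mul, norm_pow, norm_pow]
    rcases lt_or_gt_of_ne hn with h | h
    · refine ⟨y, ?_, max_eq_right (by gcongr)⟩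
      rintro rfl
      simp at h
      exact absurd h (not_lt.2 (norm_nonneg _))
    · refine ⟨x, ?_, max_eq_left (by gcongr)⟩
      rintro rfl
      simp at h
      exact absurd h (not_lt.2 (norm_nonneg _))

/-- Norms of nonzero cubes and of `p` times nonzero cubes never agree. -/
lemma norm_cube_ne (w w' : ℚ_[p]) (hw : w ≠ 0) (hw' : w' ≠ 0) :
    ‖w‖ ^ 3 ≠ (p : ℝ)⁻¹ * ‖w'‖ ^ 3 := by
  have hp1 : (1 : ℝ) < p := by exact_mod_cast (Fact.out : p.Prime).one_lt
  have hp0 : (p : ℝ) ≠ 0 := by positivity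
  rw [Padic.norm_eq_zpow_neg_valuation hw, Padic.norm_eq_zpow_neg_valuation hw',
    ← zpow_natCast, ← zpow_natCast, ← zpow_mul, ← zpow_mul, ← zpow_neg_one, ← zpow_add₀ hp0]
  intro h
  have := zpow_right_injective₀ (by positivity) hp1.ne' h
  push_cast at this
  omega

/-- The vectors with valuation vector `(0,0,1,1)`, in terms of norms. -/
def V (p : ℕ) [Fact p.Prime] : Set (Fin 4 → ℤ_[p]) :=
  {a | ‖a 0‖ = 1 ∧ ‖a 1‖ = 1 ∧ ‖a 2‖ = (p : ℝ)⁻¹ ∧ ‖a 3‖ = (p : ℝ)⁻¹}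

/-- The vectors with prescribed cubic classes of `a₁/a₀` and `a₃/a₂`. -/
def S (g : ℤ_[p]ˣ) (i j : Fin 3) : Set (Fin 4 → ℤ_[p]) :=
  {a | ∃ c d : ℤ_[p]ˣ, a 1 = ((g ^ (i : ℕ) * c ^ 3 : ℤ_[p]ˣ) : ℤ_[p]) * a 0 ∧
    a 3 = ((g ^ (j : ℕ) * d ^ 3 : ℤ_[p]ˣ) : ℤ_[p]) * a 2}

lemma norm_iff (x : ℤ_[p]) (n : ℕ) :
    (x ≠ 0 ∧ x.valuation = n) ↔ ‖x‖ = (p : ℝ) ^ (-(n : ℤ)) := by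
  have hp1 : (1 : ℝ) < p := by exact_mod_cast (Fact.out : p.Prime).one_lt
  constructor
  · rintro ⟨h, h1⟩
    rw [PadicInt.norm_eq_zpow_neg_valuation h, h1]
  · intro h
    have h0 : x ≠ 0 := by
      rintro rfl
      rw [norm_zero] at h
      exact absurd h.symm (by positivity)
    refine ⟨h0, ?_⟩
    rw [PadicInt.norm_eq_zpow_neg_valuation h0] at h
    have := zpow_right_injective₀ (by positivity) hp1.ne' h
    push_cast at this
    omega

lemma mem_V_iff (a : Fin 4 → ℤ_[p]) : ((∀ i, a i ≠ 0) ∧ (a 0).valuation = 0 ∧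
    (a 1).valuation = 0 ∧ (a 2).valuation = 1 ∧ (a 3).valuation = 1) ↔ a ∈ V p := by
  have h0 := norm_iff (a 0) 0
  have h1 := norm_iff (a 1) 0
  have h2 := norm_iff (a 2) 1
  have h3 := norm_iff (a 3) 1
  simp only [Nat.cast_zero, neg_zero, zpow_zero, Nat.cast_one, zpow_neg_one] at h0 h1 h2 h3
  rw [Fin.forall_fin_succ, Fin.forall_fin_succ, Fin.forall_fin_succ, Fin.forall_fin_succ]
  simp only [V, Set.mem_setOf_eq, ← h0, ← h1, ← h2, ← h3]
  simp
  tauto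

lemma isClosed_V : IsClosed (V p) := by
  refine IsClosed.and ?_ (IsClosed.and ?_ (IsClosed.and ?_ ?_)) <;>
  exact isClosed_eq (by fun_prop) (by fun_prop)

lemma isClosed_S (g : ℤ_[p]ˣ) (i j : Fin 3) : IsClosed (S g i j) := by
  have : S g i j = Set.range (fun q : (ℤ_[p] × ℤ_[p]) × (ℤ_[p]ˣ × ℤ_[p]ˣ) =>
      (![q.1.1, ((g ^ (i : ℕ) * q.2.1 ^ 3 : ℤ_[p]ˣ) : ℤ_[p]) * q.1.1, q.1.2,
        ((g ^ (j : ℕ) * q.2.2 ^ 3 : ℤ_[p]ˣ) : ℤ_[p]) * q.1.2] : Fin 4 → ℤ_[p])) := by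
    ext a
    constructor
    · rintro ⟨c, d, h1, h2⟩
      refine ⟨((a 0, a 2), (c, d)), ?_⟩
      ext k
      fin_cases k
      · rfl
      · exact h1.symm
      · rfl
      · exact h2.symm
    · rintro ⟨q, rfl⟩
      exact ⟨q.2.1, q.2.2, rfl, rfl⟩
  rw [this]
  refine (isCompact_range ?_).isClosed
  refine continuous_pi fun k => ?_
  have hc : Continuous (fun u : ℤ_[p]ˣ => (u : ℤ_[p])) := Units.continuous_val
  fin_cases k
  · exact continuous_fst.fst
  · exact (hc.comp (by fun_prop)).mul continuous_fst.fst
  · exact continuous_fst.snd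
  · exact (hc.comp (by fun_prop)).mul continuous_fst.snd

/-- Scaling the coordinates by units. -/
noncomputable def scale (c : Fin 4 → ℤ_[p]ˣ) : (Fin 4 → ℤ_[p]) →+ (Fin 4 → ℤ_[p]) where
  toFun a k := (c k : ℤ_[p]) * a k
  map_zero' := by ext k; simp
  map_add' a b := by ext k; simp [mul_add]

lemma scale_preserving (μ : Measure (Fin 4 → ℤ_[p])) [μ.IsAddHaarMeasure] (c : Fin 4 → ℤ_[p]ˣ) :
    MeasurePreserving (scale c) μ μ := by
  refine AddMonoidHom.measurePreserving ?_ ?_ rfl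
  · change Continuous (fun (a : Fin 4 → ℤ_[p]) k => (c k : ℤ_[p]) * a k)
    fun_prop
  · intro b
    refine ⟨fun k => ((c k)⁻¹ : ℤ_[p]ˣ) * b k, ?_⟩
    ext k
    simp [scale]

lemma measure_piece (μ : Measure (Fin 4 → ℤ_[p])) [μ.IsAddHaarMeasure] (g : ℤ_[p]ˣ)
    (i j : Fin 3) : μ (V p ∩ S g i j) = μ (V p ∩ S g 0 0) := by
  have h := (scale_preserving μ ![1, g ^ (i : ℕ), 1, g ^ (j : ℕ)]).measure_preimage
    (isClosed_V.inter (isClosed_S g i j)).measurableSet.nullMeasurableSet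
  rw [← h]
  congr 1
  ext a
  have hn : ∀ u : ℤ_[p]ˣ, ‖(u : ℤ_[p])‖ = 1 := fun u => PadicInt.isUnit_iff.1 u.isUnit
  have key : ∀ (u c : ℤ_[p]ˣ) (x y : ℤ_[p]),
      ((u : ℤ_[p]) * x = ((u * c ^ 3 : ℤ_[p]ˣ) : ℤ_[p]) * y) ↔
      x = ((g ^ ((0 : Fin 3) : ℕ) * c ^ 3 : ℤ_[p]ˣ) : ℤ_[p]) * y := by
    intro u c x y
    rw [Units.val_mul, mul_assoc, Units.mul_right_inj]
    simp
  have e0 : scale ![1, g ^ (i : ℕ), 1, g ^ (j : ℕ)] a 0 = a 0 := by simp [scale]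
  have e1 : scale ![1, g ^ (i : ℕ), 1, g ^ (j : ℕ)] a 1 = ((g ^ (i : ℕ) : ℤ_[p]ˣ) : ℤ_[p]) * a 1 :=
    rfl
  have e2 : scale ![1, g ^ (i : ℕ), 1, g ^ (j : ℕ)] a 2 = a 2 := by simp [scale]
  have e3 : scale ![1, g ^ (i : ℕ), 1, g ^ (j : ℕ)] a 3 = ((g ^ (j : ℕ) : ℤ_[p]ˣ) : ℤ_[p]) * a 3 :=
    rfl
  simp only [Set.mem_preimage, Set.mem_inter_iff, V, S, Set.mem_setOf_eq, e0, e1, e2, e3, key,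
    norm_mul, hn, one_mul]

/-- Solvability of the diagonal cubic in terms of the coefficient vector. -/
def Solv (a : Fin 4 → ℤ_[p]) : Prop :=
  ∃ x : Fin 4 → ℚ_[p], x ≠ 0 ∧
    (a 0 : ℚ_[p]) * x 0 ^ 3 + (a 1 : ℚ_[p]) * x 1 ^ 3 + (a 2 : ℚ_[p]) * x 2 ^ 3
      + (a 3 : ℚ_[p]) * x 3 ^ 3 = 0

lemma solv_of_cube {a : Fin 4 → ℤ_[p]} (c : ℤ_[p]ˣ)
    (h : a 1 = (c : ℤ_[p]) ^ 3 * a 0 ∨ a 3 = (c : ℤ_[p]) ^ 3 * a 2) : Solv a := by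
  rcases h with h | h
  · refine ⟨![-((c : ℤ_[p]) : ℚ_[p]), 1, 0, 0], ?_, ?_⟩
    · intro h0
      simpa using congrFun h0 1
    · simp [h]; ring
  · refine ⟨![0, 0, -((c : ℤ_[p]) : ℚ_[p]), 1], ?_, ?_⟩
    · intro h0
      simpa using congrFun h0 3
    · simp [h]; ring

lemma cube_of_solv (hp : p % 3 = 1) {a : Fin 4 → ℤ_[p]} (ha : a ∈ V p) (u v : ℤ_[p]ˣ)
    (h1 : a 1 = u * a 0) (h3 : a 3 = v * a 2) (hs : Solv a) :
    (∃ c : ℤ_[p]ˣ, u = c ^ 3) ∨ ∃ c : ℤ_[p]ˣ, v = c ^ 3 := by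
  by_contra hcon
  rw [not_or] at hcon
  obtain ⟨hu, hv⟩ := hcon
  obtain ⟨x, hx, he⟩ := hs
  obtain ⟨n0, -, n2, -⟩ := ha
  have hp0 : (0 : ℝ) < p := by exact_mod_cast (Fact.out : p.Prime).pos
  rw [h1, h3] at he
  push_cast at he
  have he' : (a 0 : ℚ_[p]) * (x 0 ^ 3 + ((u : ℤ_[p]) : ℚ_[p]) * x 1 ^ 3)
      = -((a 2 : ℚ_[p]) * (x 2 ^ 3 + ((v : ℤ_[p]) : ℚ_[p]) * x 3 ^ 3)) := by
    linear_combination he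
  have hN := congrArg norm he'
  rw [norm_neg, norm_mul, norm_mul, ← PadicInt.norm_def, ← PadicInt.norm_def, n0, n2,
    one_mul] at hN
  by_cases hA : x 0 = 0 ∧ x 1 = 0
  · by_cases hB : x 2 = 0 ∧ x 3 = 0
    · apply hx
      ext k
      fin_cases k
      · exact hA.1
      · exact hA.2
      · exact hB.1
      · exact hB.2
    · obtain ⟨w, hw, hw3⟩ := cubic_norm hp v hv _ _ hB
      rw [hw3, hA.1, hA.2] at hN
      have hpos : 0 < ‖w‖ := norm_pos_iff.2 hw
      have : 0 < (p : ℝ)⁻¹ * ‖w‖ ^ 3 := by positivity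
      simp at hN
      rcases hN with h | h
      · exact hp0.ne' (by exact_mod_cast h)
      · exact hw h
  · obtain ⟨w, hw, hw3⟩ := cubic_norm hp u hu _ _ hA
    by_cases hB : x 2 = 0 ∧ x 3 = 0
    · rw [hw3, hB.1, hB.2] at hN
      simp at hN
      exact hw hN
    · obtain ⟨w', hw', hw3'⟩ := cubic_norm hp v hv _ _ hB
      rw [hw3, hw3'] at hN
      exact norm_cube_ne w w' hw hw' hN

lemma measure_union (μ : Measure (Fin 4 → ℤ_[p])) [μ.IsAddHaarMeasure] (g : ℤ_[p]ˣ)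
    (hg : ∀ (i j : Fin 3) (c d : ℤ_[p]ˣ),
      g ^ (i : ℕ) * c ^ 3 = g ^ (j : ℕ) * d ^ 3 → i = j) (F : Finset (Fin 3 × Fin 3)) :
    μ (⋃ q ∈ F, V p ∩ S g q.1 q.2) = F.card * μ (V p ∩ S g 0 0) := by
  rw [measure_biUnion_finset]
  · rw [Finset.sum_congr rfl (fun q _ => measure_piece μ g q.1 q.2)]
    simp
  · intro q _ r _ hqr
    refine Set.disjoint_left.2 ?_
    rintro a ⟨ha, c, d, h1, h2⟩ ⟨-, c', d', h1', h2'⟩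
    have hp0 : (0 : ℝ) < (p : ℝ)⁻¹ :=
      inv_pos.2 (by exact_mod_cast (Fact.out : p.Prime).pos)
    have a0 : a 0 ≠ 0 := norm_pos_iff.1 (by rw [ha.1]; norm_num)
    have a2 : a 2 ≠ 0 := norm_pos_iff.1 (by rw [ha.2.2.1]; exact hp0)
    rw [h1] at h1'
    rw [h2] at h2'
    have k1 := hg _ _ _ _ (Units.ext (mul_right_cancel₀ a0 h1'))
    have k2 := hg _ _ _ _ (Units.ext (mul_right_cancel₀ a2 h2'))
    exact hqr (Prod.ext k1 k2)
  · intro q _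
    exact (isClosed_V.inter (isClosed_S g _ _)).measurableSet

lemma exists_class {g : ℤ_[p]ˣ}
    (hg : ∀ u : ℤ_[p]ˣ, ∃ i : Fin 3, ∃ c : ℤ_[p]ˣ, u = g ^ (i : ℕ) * c ^ 3)
    {a : Fin 4 → ℤ_[p]} (ha : a ∈ V p) : ∃ i j : Fin 3, a ∈ S g i j := by
  have hp0 : (0 : ℝ) < (p : ℝ)⁻¹ :=
    inv_pos.2 (by exact_mod_cast (Fact.out : p.Prime).pos)
  have a0 : a 0 ≠ 0 := norm_pos_iff.1 (by rw [ha.1]; norm_num)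
  have a2 : a 2 ≠ 0 := norm_pos_iff.1 (by rw [ha.2.2.1]; exact hp0)
  obtain ⟨u, hu⟩ := unit_ratio (a 1) (a 0) a0 (by rw [ha.1, ha.2.1])
  obtain ⟨v, hv⟩ := unit_ratio (a 3) (a 2) a2 (by rw [ha.2.2.1, ha.2.2.2])
  obtain ⟨i, c, hc⟩ := hg u
  obtain ⟨j, d, hd⟩ := hg v
  exact ⟨i, j, c, d, by rw [← hc, hu], by rw [← hd, hv]⟩

end DiagCubic

/-- For a prime `p ≡ 1 (mod 3)`, among coefficient vectors `a ∈ ℤ_p⁴` with valuation vector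
`v(a) = (0,0,1,1)`, the density of those for which the diagonal cubic surface
`S_a : a₀x₀³ + a₁x₁³ + a₂x₂³ + a₃x₃³ = 0` has a `ℚ_p`-point is `5/9`;
here `μ` is the Haar measure on `ℤ_p⁴` normalized by `μ(ℤ_p⁴) = 1`. -/
theorem density_diagonal_cubic_valuation_0011 (p : ℕ) [Fact p.Prime] (hp : p % 3 = 1)
    (μ : Measure (Fin 4 → ℤ_[p])) [μ.IsAddHaarMeasure] (hμ : μ Set.univ = 1) :
    (μ {a : Fin 4 → ℤ_[p] | ((∀ i, a i ≠ 0) ∧ (a 0).valuation = 0 ∧ (a 1).valuation = 0 ∧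
          (a 2).valuation = 1 ∧ (a 3).valuation = 1) ∧
        ∃ x : Fin 4 → ℚ_[p], x ≠ 0 ∧
          (a 0 : ℚ_[p]) * x 0 ^ 3 + (a 1 : ℚ_[p]) * x 1 ^ 3 + (a 2 : ℚ_[p]) * x 2 ^ 3
            + (a 3 : ℚ_[p]) * x 3 ^ 3 = 0}).toReal
      = (5 / 9) *
        (μ {a : Fin 4 → ℤ_[p] | (∀ i, a i ≠ 0) ∧ (a 0).valuation = 0 ∧ (a 1).valuation = 0 ∧
          (a 2).valuation = 1 ∧ (a 3).valuation = 1}).toReal := by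
  obtain ⟨g, hg1, hg2⟩ := DiagCubic.exists_gen hp
  have hV : {a : Fin 4 → ℤ_[p] | (∀ i, a i ≠ 0) ∧ (a 0).valuation = 0 ∧ (a 1).valuation = 0 ∧
      (a 2).valuation = 1 ∧ (a 3).valuation = 1} =
      ⋃ q ∈ (Finset.univ : Finset (Fin 3 × Fin 3)), DiagCubic.V p ∩ DiagCubic.S g q.1 q.2 := by
    ext a
    rw [Set.mem_setOf_eq, DiagCubic.mem_V_iff]
    simp only [Set.mem_iUnion, Finset.mem_univ, exists_prop, true_and, Set.mem_inter_iff]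
    constructor
    · intro ha
      obtain ⟨i, j, h⟩ := DiagCubic.exists_class hg1 ha
      exact ⟨(i, j), ha, h⟩
    · rintro ⟨q, ha, -⟩
      exact ha
  have hS : {a : Fin 4 → ℤ_[p] | ((∀ i, a i ≠ 0) ∧ (a 0).valuation = 0 ∧ (a 1).valuation = 0 ∧
          (a 2).valuation = 1 ∧ (a 3).valuation = 1) ∧
        ∃ x : Fin 4 → ℚ_[p], x ≠ 0 ∧
          (a 0 : ℚ_[p]) * x 0 ^ 3 + (a 1 : ℚ_[p]) * x 1 ^ 3 + (a 2 : ℚ_[p]) * x 2 ^ 3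
            + (a 3 : ℚ_[p]) * x 3 ^ 3 = 0} =
      ⋃ q ∈ (Finset.univ.filter (fun q : Fin 3 × Fin 3 => q.1 = 0 ∨ q.2 = 0)),
        DiagCubic.V p ∩ DiagCubic.S g q.1 q.2 := by
    ext a
    rw [Set.mem_setOf_eq, DiagCubic.mem_V_iff]
    simp only [Set.mem_iUnion, Finset.mem_filter, Finset.mem_univ, exists_prop, true_and,
      Set.mem_inter_iff]
    constructor
    · rintro ⟨ha, hs⟩
      obtain ⟨i, j, h⟩ := DiagCubic.exists_class hg1 ha
      refine ⟨(i, j), ?_, ha, h⟩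
      obtain ⟨c, d, h1, h3⟩ := h
      rcases DiagCubic.cube_of_solv hp ha _ _ h1 h3 hs with ⟨e, he⟩ | ⟨e, he⟩
      · exact Or.inl (hg2 i 0 c e (by rw [he]; simp))
      · exact Or.inr (hg2 j 0 d e (by rw [he]; simp))
    · rintro ⟨⟨i, j⟩, hq, ha, c, d, h1, h3⟩
      refine ⟨ha, ?_⟩
      rcases hq with hq | hq
      · simp only at hq
        subst hq
        exact DiagCubic.solv_of_cube c (Or.inl (by simpa using h1))
      · simp only at hq
        subst hq
        exact DiagCubic.solv_of_cube d (Or.inr (by simpa using h3))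
  rw [hV, hS, DiagCubic.measure_union μ g hg2, DiagCubic.measure_union μ g hg2]
  have c1 : (Finset.univ.filter (fun q : Fin 3 × Fin 3 => q.1 = 0 ∨ q.2 = 0)).card = 5 := by
    decide
  have c2 : (Finset.univ : Finset (Fin 3 × Fin 3)).card = 9 := by decide
  rw [c1, c2, ENNReal.toReal_mul, ENNReal.toReal_mul]
  simp only [ENNReal.toReal_natCast]
  push_cast
  ring
end

section
/- Let p be a prime with p ≡ 1 (mod 3). Then μ_p({a ∈ ℤ_p⁴ : v(a) = (0,0,1,2) and S_a(ℚ_p) ≠ ∅}) = (1/3) · μ_p({a ∈ ℤ_p⁴ : v(a) = (0,0,1,2)}). -/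
open MeasureTheory

lemma zmod_cubes (p : ℕ) [Fact p.Prime] (hp : p % 3 = 1) : ∃ g : ZMod p, g ≠ 0 ∧
    (∀ z : ZMod p, z ≠ 0 → ∃ i < 3, ∃ c : ZMod p, z = c ^ 3 * g ^ i) ∧
    (∀ i < 3, ∀ j < 3, ∀ c d : ZMod p, c ≠ 0 → d ≠ 0 → c ^ 3 * g ^ i = d ^ 3 * g ^ j → i = j) := by
  obtain ⟨g, hg⟩ := IsCyclic.exists_generator (α := (ZMod p)ˣ)
  have hord : orderOf g = p - 1 := by
    rw [orderOf_eq_card_of_forall_mem_zpowers hg, Nat.card_eq_fintype_card, ZMod.card_units]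
  have hgen : ∀ z : ZMod p, z ≠ 0 → ∃ n : ℕ, z = (g : ZMod p) ^ n := by
    intro z hz
    obtain ⟨n, hn⟩ := (mem_powers_iff_mem_zpowers (x := g)).2 (hg (Units.mk0 z hz))
    refine ⟨n, ?_⟩
    have := congrArg Units.val hn
    simpa using this.symm
  refine ⟨g, g.ne_zero, ?_, ?_⟩
  · intro z hz
    obtain ⟨n, rfl⟩ := hgen z hz
    refine ⟨n % 3, Nat.mod_lt _ (by norm_num), (g : ZMod p) ^ (n / 3), ?_⟩
    rw [← pow_mul, ← pow_add]
    congr 1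
    omega
  · intro i hi j hj c d hc hd h
    obtain ⟨m, rfl⟩ := hgen c hc
    obtain ⟨n, rfl⟩ := hgen d hd
    rw [← pow_mul, ← pow_add, ← pow_mul, ← pow_add] at h
    have h2 : g ^ (m * 3 + i) = g ^ (n * 3 + j) := by
      ext; simpa using h
    rw [pow_eq_pow_iff_modEq, hord] at h2
    have h3 : (m * 3 + i) ≡ (n * 3 + j) [MOD 3] := h2.of_dvd (by omega)
    unfold Nat.ModEq at h3
    omega

lemma toZMod_zero_iff {p : ℕ} [Fact p.Prime] (x : ℤ_[p]) :
    PadicInt.toZMod x = 0 ↔ (p : ℤ_[p]) ∣ x := by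
  rw [← RingHom.mem_ker, PadicInt.ker_toZMod, PadicInt.maximalIdeal_eq_span_p,
    Ideal.mem_span_singleton]

lemma padic_unit_iff {p : ℕ} [Fact p.Prime] (x : ℤ_[p]) : IsUnit x ↔ ¬ (p : ℤ_[p]) ∣ x := by
  rw [← PadicInt.norm_lt_one_iff_dvd, PadicInt.isUnit_iff, not_lt]
  exact ⟨fun h => h.ge, fun h => le_antisymm (PadicInt.norm_le_one _) h⟩

lemma padic_cubes (p : ℕ) [Fact p.Prime] (hp : p % 3 = 1) : ∃ w : ℤ_[p], IsUnit w ∧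
    (∀ x y : ℤ_[p], IsUnit x → IsUnit y → ∃ i < 3, ∃ c, (p : ℤ_[p]) ∣ x - y * c ^ 3 * w ^ i) ∧
    (∀ i < 3, ∀ j < 3, ∀ x y c d : ℤ_[p], IsUnit x → IsUnit y →
      (p : ℤ_[p]) ∣ x - y * c ^ 3 * w ^ i → (p : ℤ_[p]) ∣ x - y * d ^ 3 * w ^ j → i = j) := by
  obtain ⟨g, hg, h1, h2⟩ := zmod_cubes p hp
  have hs := ZMod.ringHom_surjective (PadicInt.toZMod (p := p))
  obtain ⟨w, rfl⟩ := hs g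
  have hu : ∀ x : ℤ_[p], IsUnit x ↔ PadicInt.toZMod x ≠ 0 := fun x => by
    rw [padic_unit_iff, ← toZMod_zero_iff]
  refine ⟨w, (hu w).2 hg, ?_, ?_⟩
  · intro x y hx hy
    rw [hu] at hx hy
    obtain ⟨i, hi, c, hc⟩ := h1 (PadicInt.toZMod x / PadicInt.toZMod y) (div_ne_zero hx hy)
    obtain ⟨c, rfl⟩ := hs c
    refine ⟨i, hi, c, ?_⟩
    rw [← toZMod_zero_iff]
    rw [div_eq_iff hy] at hc
    simp only [map_sub, map_mul, map_pow, hc]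
    ring
  · intro i hi j hj x y c d hx hy hc hd
    rw [hu] at hx hy
    rw [← toZMod_zero_iff] at hc hd
    simp only [map_sub, map_mul, map_pow, sub_eq_zero] at hc hd
    refine h2 i hi j hj (PadicInt.toZMod c) (PadicInt.toZMod d) ?_ ?_ ?_
    · intro h; rw [h] at hc; simp at hc; exact hx hc
    · intro h; rw [h] at hd; simp at hd; exact hx hd
    · apply mul_left_cancel₀ hy
      linear_combination hd - hc

lemma hensel_dir (p : ℕ) [Fact p.Prime] (hp : p % 3 = 1) (a b c : ℤ_[p]) (ha : IsUnit a)
    (hb : IsUnit b) (h : (p : ℤ_[p]) ∣ a - b * c ^ 3) : ∃ z : ℤ_[p], a + b * z ^ 3 = 0 := by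
  have h3 : IsUnit (3 : ℤ_[p]) := by
    rw [padic_unit_iff, ← toZMod_zero_iff]
    rw [show (3 : ℤ_[p]) = ((3 : ℕ) : ℤ_[p]) by norm_num, map_natCast, ZMod.natCast_eq_zero_iff]
    intro h
    have h1 := Nat.le_of_dvd (by norm_num) h
    have h2 := (Fact.out : p.Prime).two_le
    interval_cases p <;> omega
  have hc : IsUnit c := by
    rw [padic_unit_iff] at ha ⊢
    intro hc
    apply ha
    have : a = (a - b * c ^ 3) + b * c ^ 2 * c := by ring
    rw [this]
    exact dvd_add h (Dvd.dvd.mul_left hc _)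
  have key := hensels_lemma (p := p) (R := ℤ_[p])
    (F := Polynomial.C a + Polynomial.C b * Polynomial.X ^ 3) (a := -c) ?_
  · obtain ⟨z, hz, -⟩ := key
    exact ⟨z, by simpa using hz⟩
  · have hd : ‖(3 : ℤ_[p]) * b * c ^ 2‖ = 1 := by
      rw [← PadicInt.isUnit_iff]
      exact (h3.mul hb).mul (hc.pow 2)
    have e1 : (Polynomial.aeval (-c)) (Polynomial.C a + Polynomial.C b * Polynomial.X ^ 3)
        = a - b * c ^ 3 := by
      simp; ring
    have e2 : (Polynomial.aeval (-c)) (Polynomial.derivative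
        (Polynomial.C a + Polynomial.C b * Polynomial.X ^ 3)) = 3 * b * c ^ 2 := by
      simp; ring
    rw [e1, e2, hd, one_pow]
    exact (PadicInt.norm_lt_one_iff_dvd _).2 h

lemma descent (p : ℕ) [Fact p.Prime] (a b u v x y z t : ℤ_[p]) (ha : IsUnit a)
    (hb : IsUnit b) (hu : IsUnit u) (hv : IsUnit v)
    (h : a * x ^ 3 + b * y ^ 3 + u * p * z ^ 3 + v * p ^ 2 * t ^ 3 = 0)
    (hne : ¬ ((p : ℤ_[p]) ∣ x ∧ (p : ℤ_[p]) ∣ y ∧ (p : ℤ_[p]) ∣ z ∧ (p : ℤ_[p]) ∣ t)) :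
    ∃ c, (p : ℤ_[p]) ∣ a - b * c ^ 3 := by
  have hP : Prime (p : ℤ_[p]) := PadicInt.prime_p
  have hdvd : ∀ a x : ℤ_[p], IsUnit a → (p : ℤ_[p]) ∣ a * x ^ 3 → (p : ℤ_[p]) ∣ x := by
    intro a x ha h
    exact hP.dvd_of_dvd_pow ((ha.dvd_mul_left).1 h)
  by_cases hx : (p : ℤ_[p]) ∣ x
  · exfalso
    obtain ⟨x, rfl⟩ := hx
    have hy : (p : ℤ_[p]) ∣ y := hdvd b y hb
      ⟨-(a * p ^ 2 * x ^ 3 + u * z ^ 3 + v * p * t ^ 3), by linear_combination h⟩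
    obtain ⟨y, rfl⟩ := hy
    have h2 : a * p ^ 2 * x ^ 3 + b * p ^ 2 * y ^ 3 + u * z ^ 3 + v * p * t ^ 3 = 0 := by
      apply mul_left_cancel₀ hP.ne_zero
      linear_combination h
    have hz : (p : ℤ_[p]) ∣ z := hdvd u z hu
      ⟨-(a * p * x ^ 3 + b * p * y ^ 3 + v * t ^ 3), by linear_combination h2⟩
    obtain ⟨z, rfl⟩ := hz
    have h3 : a * p * x ^ 3 + b * p * y ^ 3 + u * p ^ 2 * z ^ 3 + v * t ^ 3 = 0 := by
      apply mul_left_cancel₀ hP.ne_zero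
      linear_combination h2
    have ht : (p : ℤ_[p]) ∣ t := hdvd v t hv
      ⟨-(a * x ^ 3 + b * y ^ 3 + u * p * z ^ 3), by linear_combination h3⟩
    exact hne ⟨dvd_mul_right _ _, dvd_mul_right _ _, dvd_mul_right _ _, ht⟩
  · obtain ⟨x', hx'⟩ := ((padic_unit_iff x).2 hx).exists_right_inv
    refine ⟨-(y * x'), -(u * z ^ 3 + v * p * t ^ 3) * x' ^ 3, ?_⟩
    have : x ^ 3 * x' ^ 3 = 1 := by rw [← mul_pow, hx', one_pow]
    linear_combination h * x' ^ 3 - a * this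

lemma of_valuation (p : ℕ) [Fact p.Prime] (a : ℤ_[p]) (h : a ≠ 0) :
    ∃ u : ℤ_[p], IsUnit u ∧ a = u * p ^ a.valuation :=
  ⟨PadicInt.unitCoeff h, Units.isUnit _, PadicInt.unitCoeff_spec h⟩

lemma unit_of_val (p : ℕ) [Fact p.Prime] (a : ℤ_[p]) (h : a ≠ 0) (h0 : a.valuation = 0) :
    IsUnit a := by
  obtain ⟨u, hu, e⟩ := of_valuation p a h
  rw [e, h0]; simpa using hu

lemma solvable_iff (p : ℕ) [Fact p.Prime] (hp : p % 3 = 1) (a : Fin 4 → ℤ_[p])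
    (hA : (∀ i, a i ≠ 0) ∧ (a 0).valuation = 0 ∧ (a 1).valuation = 0 ∧
          (a 2).valuation = 1 ∧ (a 3).valuation = 2) :
    (∃ x : Fin 4 → ℚ_[p], x ≠ 0 ∧
          (a 0 : ℚ_[p]) * x 0 ^ 3 + (a 1 : ℚ_[p]) * x 1 ^ 3 + (a 2 : ℚ_[p]) * x 2 ^ 3
            + (a 3 : ℚ_[p]) * x 3 ^ 3 = 0) ↔ ∃ c, (p : ℤ_[p]) ∣ a 0 - a 1 * c ^ 3 := by
  obtain ⟨hn, h0, h1, h2, h3⟩ := hA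
  have u0 := unit_of_val p _ (hn 0) h0
  have u1 := unit_of_val p _ (hn 1) h1
  obtain ⟨u, hu, eu⟩ := of_valuation p _ (hn 2)
  obtain ⟨v, hv, ev⟩ := of_valuation p _ (hn 3)
  rw [h2, pow_one] at eu
  rw [h3] at ev
  constructor
  · rintro ⟨x, hx, h⟩
    obtain ⟨k, hk⟩ := Finite.exists_max (fun i => ‖x i‖)
    have hk0 : x k ≠ 0 := by
      intro h0
      apply hx
      funext i
      have := hk i
      simpa [h0] using this
    have hle : ∀ i, ‖x i / x k‖ ≤ 1 := fun i => by
      rw [norm_div]; exact div_le_one_of_le₀ (hk i) (norm_nonneg _)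
    let y : Fin 4 → ℤ_[p] := fun i => ⟨x i / x k, hle i⟩
    have hy : ∀ i, (y i : ℚ_[p]) = x i / x k := fun i => rfl
    have hyk : y k = 1 := by
      apply Subtype.ext; change x k / x k = 1; exact div_self hk0
    refine descent p (a 0) (a 1) u v (y 0) (y 1) (y 2) (y 3) u0 u1 hu hv ?_ ?_
    · rw [← eu, ← ev]
      apply Subtype.ext
      push_cast
      simp only [hy]
      field_simp
      rw [mul_zero]; exact h
    · rintro ⟨d0, d1, d2, d3⟩
      have : (p : ℤ_[p]) ∣ y k := by fin_cases k <;> assumption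
      rw [hyk] at this
      exact PadicInt.prime_p.not_dvd_one this
  · rintro ⟨c, hc⟩
    obtain ⟨z, hz⟩ := hensel_dir p hp _ _ c u0 u1 hc
    refine ⟨![1, z, 0, 0], fun h => by simpa using congrFun h 0, ?_⟩
    have := congrArg (fun t : ℤ_[p] => (t : ℚ_[p])) hz
    simpa using this

/-- Multiplication of the first coordinate by a unit, as an additive equivalence. -/
noncomputable def scaleHom (p : ℕ) [Fact p.Prime] (w : ℤ_[p]) :
    (Fin 4 → ℤ_[p]) →+ (Fin 4 → ℤ_[p]) where
  toFun a := ![w * a 0, a 1, a 2, a 3]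
  map_zero' := by ext i; fin_cases i <;> simp
  map_add' a b := by ext i; fin_cases i <;> simp [mul_add]

lemma scale_continuous (p : ℕ) [Fact p.Prime] (w : ℤ_[p]) : Continuous (scaleHom p w) := by
  refine continuous_pi fun i => ?_
  fin_cases i <;> simp [scaleHom] <;> fun_prop

lemma scale_pres (p : ℕ) [Fact p.Prime] (w : ℤ_[p]) (hw : IsUnit w)
    (μ : Measure (Fin 4 → ℤ_[p])) [μ.IsAddHaarMeasure] (hμ : μ Set.univ = 1) :
    μ.map (scaleHom p w) = μ := by
  haveI : IsProbabilityMeasure μ := ⟨hμ⟩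
  have hc := scale_continuous p w
  haveI := Measure.isAddHaarMeasure_map_of_isFiniteMeasure μ (scaleHom p w) hc (by
    intro b
    obtain ⟨w', hw'⟩ := hw.exists_right_inv
    refine ⟨![w' * b 0, b 1, b 2, b 3], ?_⟩
    ext i; fin_cases i <;> simp [scaleHom, ← mul_assoc, hw'])
  haveI : IsProbabilityMeasure (μ.map (scaleHom p w)) :=
    Measure.isProbabilityMeasure_map hc.measurable.aemeasurable
  exact Measure.isAddHaarMeasure_eq_of_isProbabilityMeasure _ _

lemma meas_val (p : ℕ) [Fact p.Prime] (k : ℕ) :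
    MeasurableSet {x : ℤ_[p] | x ≠ 0 ∧ x.valuation = k} := by
  have : {x : ℤ_[p] | x ≠ 0 ∧ x.valuation = k} = {x | ‖x‖ = (p : ℝ) ^ (-k : ℤ)} := by
    have hp0 : (0 : ℝ) < p := by exact_mod_cast (Fact.out : p.Prime).pos
    have hp1 : (1 : ℝ) < p := by exact_mod_cast (Fact.out : p.Prime).one_lt
    ext x
    simp only [Set.mem_setOf_eq]
    constructor
    · rintro ⟨h, rfl⟩
      exact PadicInt.norm_eq_zpow_neg_valuation h
    · intro h
      have hx : x ≠ 0 := by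
        rintro rfl
        rw [norm_zero] at h
        exact (zpow_pos hp0 _).ne h
      refine ⟨hx, ?_⟩
      rw [PadicInt.norm_eq_zpow_neg_valuation hx] at h
      have := zpow_right_injective₀ hp0 hp1.ne' h
      simpa using this
  rw [this]
  exact (isClosed_eq continuous_norm continuous_const).measurableSet

/-- For a prime `p ≡ 1 (mod 3)`, among coefficient vectors `a ∈ ℤ_p⁴` with valuation vector
`v(a) = (0,0,1,2)`, the density of those for which the diagonal cubic surface
`S_a : a₀x₀³ + a₁x₁³ + a₂x₂³ + a₃x₃³ = 0` has a `ℚ_p`-point is `1/3`;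
here `μ` is the Haar measure on `ℤ_p⁴` normalized by `μ(ℤ_p⁴) = 1`. -/
theorem density_diagonal_cubic_valuation_0012 (p : ℕ) [Fact p.Prime] (hp : p % 3 = 1)
    (μ : Measure (Fin 4 → ℤ_[p])) [μ.IsAddHaarMeasure] (hμ : μ Set.univ = 1) :
    (μ {a : Fin 4 → ℤ_[p] | ((∀ i, a i ≠ 0) ∧ (a 0).valuation = 0 ∧ (a 1).valuation = 0 ∧
          (a 2).valuation = 1 ∧ (a 3).valuation = 2) ∧
        ∃ x : Fin 4 → ℚ_[p], x ≠ 0 ∧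
          (a 0 : ℚ_[p]) * x 0 ^ 3 + (a 1 : ℚ_[p]) * x 1 ^ 3 + (a 2 : ℚ_[p]) * x 2 ^ 3
            + (a 3 : ℚ_[p]) * x 3 ^ 3 = 0}).toReal
      = (1 / 3) *
        (μ {a : Fin 4 → ℤ_[p] | (∀ i, a i ≠ 0) ∧ (a 0).valuation = 0 ∧ (a 1).valuation = 0 ∧
          (a 2).valuation = 1 ∧ (a 3).valuation = 2}).toReal := by
  haveI : IsProbabilityMeasure μ := ⟨hμ⟩
  obtain ⟨w, hw, hcov, hdis⟩ := padic_cubes p hp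
  set A : Set (Fin 4 → ℤ_[p]) := {a | (∀ i, a i ≠ 0) ∧ (a 0).valuation = 0 ∧
    (a 1).valuation = 0 ∧ (a 2).valuation = 1 ∧ (a 3).valuation = 2} with hAdef
  let B : ℕ → Set (Fin 4 → ℤ_[p]) := fun i =>
    A ∩ {a | ∃ c, (p : ℤ_[p]) ∣ a 0 - a 1 * c ^ 3 * w ^ i}
  have hAm : MeasurableSet A := by
    have : A = ⋂ i : Fin 4, (fun a : Fin 4 → ℤ_[p] => a i) ⁻¹'
        {x | x ≠ 0 ∧ x.valuation = (![0, 0, 1, 2] : Fin 4 → ℕ) i} := by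
      ext a
      simp [hAdef, Fin.forall_fin_succ]
      tauto
    rw [this]
    exact MeasurableSet.iInter fun i => measurable_pi_apply i (meas_val p _)
  have hBm : ∀ i, MeasurableSet (B i) := by
    intro i
    refine hAm.inter (IsOpen.measurableSet ?_)
    simp only [Set.setOf_exists, ← PadicInt.norm_lt_one_iff_dvd]
    exact isOpen_iUnion fun c => isOpen_lt (by fun_prop) continuous_const
  have hunit : ∀ a ∈ A, IsUnit (a 0) ∧ IsUnit (a 1) := fun a ha =>
    ⟨unit_of_val p _ (ha.1 0) ha.2.1, unit_of_val p _ (ha.1 1) ha.2.2.1⟩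
  have hset : {a : Fin 4 → ℤ_[p] | ((∀ i, a i ≠ 0) ∧ (a 0).valuation = 0 ∧
        (a 1).valuation = 0 ∧ (a 2).valuation = 1 ∧ (a 3).valuation = 2) ∧
        ∃ x : Fin 4 → ℚ_[p], x ≠ 0 ∧
          (a 0 : ℚ_[p]) * x 0 ^ 3 + (a 1 : ℚ_[p]) * x 1 ^ 3 + (a 2 : ℚ_[p]) * x 2 ^ 3
            + (a 3 : ℚ_[p]) * x 3 ^ 3 = 0} = B 0 := by
    ext a
    constructor
    · rintro ⟨h1, h2⟩
      exact ⟨h1, by simpa using (solvable_iff p hp a h1).1 h2⟩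
    · rintro ⟨h1, h2⟩
      exact ⟨h1, (solvable_iff p hp a h1).2 (by simpa using h2)⟩
  have hw0 : w ≠ 0 := hw.ne_zero
  have hwv : w.valuation = 0 := by
    have := PadicInt.norm_eq_zpow_neg_valuation hw0
    rw [PadicInt.isUnit_iff.1 hw] at this
    have hp1 : (1 : ℝ) < p := by exact_mod_cast (Fact.out : p.Prime).one_lt
    have h2 := (zpow_eq_one_iff_right₀ (by linarith) hp1.ne').1 this.symm
    simpa using h2
  have hTA : ∀ a, scaleHom p w a ∈ A ↔ a ∈ A := by
    intro a
    simp only [hAdef, Set.mem_setOf_eq, Fin.forall_fin_succ, scaleHom]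
    by_cases h0 : a 0 = 0
    · simp [h0]
    · simp [hw0, h0, hwv, PadicInt.valuation_mul hw0 h0]
  have hstep : ∀ i, μ (B i) = μ (B (i + 1)) := by
    intro i
    conv_rhs => rw [← scale_pres p w hw μ hμ]
    rw [Measure.map_apply (scale_continuous p w).measurable (hBm _)]
    congr 1
    ext a
    simp only [B, Set.mem_preimage, Set.mem_inter_iff, hTA, Set.mem_setOf_eq]
    refine and_congr_right fun _ => exists_congr fun c => ?_
    have : (scaleHom p w a) 0 - (scaleHom p w a) 1 * c ^ 3 * w ^ (i + 1)
        = w * (a 0 - a 1 * c ^ 3 * w ^ i) := by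
      simp [scaleHom]; ring
    rw [this, hw.dvd_mul_left]
  have hdisj : ∀ i < 3, ∀ j < 3, i ≠ j → Disjoint (B i) (B j) := by
    intro i hi j hj hij
    rw [Set.disjoint_left]
    rintro a ⟨ha, c, hc⟩ ⟨-, d, hd⟩
    exact hij (hdis i hi j hj _ _ c d (hunit a ha).1 (hunit a ha).2 hc hd)
  have hunion : A = B 0 ∪ (B 1 ∪ B 2) := by
    ext a
    constructor
    · intro ha
      obtain ⟨i, hi, c, hc⟩ := hcov _ _ (hunit a ha).1 (hunit a ha).2
      interval_cases i
      · exact Or.inl ⟨ha, c, hc⟩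
      · exact Or.inr (Or.inl ⟨ha, c, hc⟩)
      · exact Or.inr (Or.inr ⟨ha, c, hc⟩)
    · rintro (h | h | h) <;> exact h.1
  have hsum : μ A = μ (B 0) + (μ (B 0) + μ (B 0)) := by
    rw [hunion, measure_union _ ((hBm 1).union (hBm 2)),
      measure_union (hdisj 1 (by norm_num) 2 (by norm_num) (by norm_num)) (hBm 2),
      ← hstep 1, ← hstep 0]
    exact Set.disjoint_union_right.2 ⟨hdisj 0 (by norm_num) 1 (by norm_num) (by norm_num),
      hdisj 0 (by norm_num) 2 (by norm_num) (by norm_num)⟩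
  rw [hset, hsum, ENNReal.toReal_add (measure_ne_top _ _) (by finiteness),
    ENNReal.toReal_add (measure_ne_top _ _) (measure_ne_top _ _)]
  ring
end

section
/- For p = 3 one has μ_3({a ∈ ℤ_3⁴ : v(a) = (0,0,0,2) and S_a(ℚ_3) ≠ ∅}) = (7/9) · μ_3({a ∈ ℤ_3⁴ : v(a) = (0,0,0,2)}). -/
open MeasureTheory

namespace CubicAux

/-- Reduction modulo nine. -/
noncomputable def red : ℤ_[3] →+* ZMod 9 := PadicInt.toZModPow 2

lemma red_eq_zero (x : ℤ_[3]) : red x = 0 ↔ (9 : ℤ_[3]) ∣ x := by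
  have h := PadicInt.ker_toZModPow (p := 3) 2
  have h2 : red x = 0 ↔ x ∈ RingHom.ker (PadicInt.toZModPow 2 : ℤ_[3] →+* ZMod (3 ^ 2)) :=
    (RingHom.mem_ker).symm
  rw [h2, h, Ideal.mem_span_singleton]
  norm_num

lemma red_surj (r : ZMod 9) : ∃ x, red x = r :=
  ⟨(r.val : ℤ_[3]), by rw [map_natCast]; exact ZMod.natCast_zmod_val r⟩

lemma three_ne : (3 : ℤ_[3]) ≠ 0 := by norm_num

lemma red_three (x : ℤ_[3]) : 3 * red x = 0 ↔ (3 : ℤ_[3]) ∣ x := by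
  have h : 3 * red x = red (3 * x) := by rw [map_mul, map_ofNat]
  rw [h, red_eq_zero, show (9 : ℤ_[3]) = 3 * 3 by norm_num, mul_dvd_mul_iff_left three_ne]

lemma isUnit_iff_red (x : ℤ_[3]) : IsUnit x ↔ 3 * red x ≠ 0 := by
  rw [Ne, red_three, ← not_iff_not, not_not, PadicInt.not_isUnit_iff,
    PadicInt.norm_lt_one_iff_dvd]
  norm_num

lemma val_zero_iff (x : ℤ_[3]) : (x ≠ 0 ∧ x.valuation = 0) ↔ 3 * red x ≠ 0 := by
  rw [← isUnit_iff_red, PadicInt.isUnit_iff]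
  constructor
  · rintro ⟨h, h0⟩
    rw [PadicInt.norm_eq_zpow_neg_valuation h, h0]; simp
  · intro h
    have hx : x ≠ 0 := by rintro rfl; simp at h
    refine ⟨hx, ?_⟩
    by_contra h0
    have h1 := (PadicInt.norm_le_pow_iff_le_valuation x hx 1).2 (by omega)
    rw [h] at h1
    norm_num at h1

lemma cube_root (k : ℤ_[3]) : ∃ t : ℤ_[3], t ^ 3 = 1 + 9 * k := by
  let F : Polynomial ℤ_[3] := Polynomial.X ^ 3 - Polynomial.C (1 + 9 * k)
  have e1 : F.aeval (1 + 3 * k) = 3 ^ 3 * (k ^ 2 + k ^ 3) := by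
    simp [F]; ring
  have e2 : F.derivative.aeval (1 + 3 * k) = 3 * (1 + 3 * k) ^ 2 := by
    simp [F]
    norm_num
  have n3 : ‖(3 : ℤ_[3])‖ = 1 / 3 := by
    have := PadicInt.norm_p (p := 3)
    norm_num at this ⊢
    exact this
  have nu : ‖(1 + 3 * k : ℤ_[3])‖ = 1 := by
    rw [← PadicInt.isUnit_iff, isUnit_iff_red]
    intro h
    rw [red_three] at h
    have : (3 : ℤ_[3]) ∣ 1 := (dvd_add_left (dvd_mul_right 3 k)).1 h
    have h2 := isUnit_of_dvd_one this
    rw [PadicInt.isUnit_iff, n3] at h2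
    norm_num at h2
  obtain ⟨z, hz, -⟩ := hensels_lemma (F := F) (a := 1 + 3 * k) (by
    rw [e1, e2, norm_mul, norm_mul, norm_pow, norm_pow, nu, n3]
    have := PadicInt.norm_le_one (k ^ 2 + k ^ 3)
    nlinarith)
  refine ⟨z, ?_⟩
  simp [F] at hz
  linear_combination hz

lemma cube_ratio (a b : ℤ_[3]) (hb : 3 * red b ≠ 0) (h : red a = red b ∨ red a = - red b) :
    ∃ t : ℤ_[3], a = b * t ^ 3 := by
  rw [← isUnit_iff_red] at hb
  obtain ⟨c, hc⟩ := hb.exists_right_inv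
  rcases h with h | h
  · have : red (a - b) = 0 := by rw [map_sub, h, sub_self]
    obtain ⟨m, hm⟩ := (red_eq_zero _).1 this
    obtain ⟨t, ht⟩ := cube_root (m * c)
    exact ⟨t, by rw [ht]; linear_combination hm - 9 * m * hc⟩
  · have : red (a + b) = 0 := by rw [map_add, h, neg_add_cancel]
    obtain ⟨m, hm⟩ := (red_eq_zero _).1 this
    obtain ⟨t, ht⟩ := cube_root (-m * c)
    exact ⟨-t, by
      have : (-t) ^ 3 = - (t ^ 3) := by ring
      rw [this, ht]; linear_combination hm - 9 * m * hc⟩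

/-- All three residues are units. -/
def U (r : ZMod 9 × ZMod 9 × ZMod 9) : Prop :=
  3 * r.1 ≠ 0 ∧ 3 * r.2.1 ≠ 0 ∧ 3 * r.2.2 ≠ 0

/-- Two of the residues agree up to sign. -/
def G (r : ZMod 9 × ZMod 9 × ZMod 9) : Prop :=
  (r.1 = r.2.1 ∨ r.1 = -r.2.1) ∨ (r.1 = r.2.2 ∨ r.1 = -r.2.2) ∨
    (r.2.1 = r.2.2 ∨ r.2.1 = -r.2.2)

instance : DecidablePred U := fun r => by unfold U; infer_instance
instance : DecidablePred G := fun r => by unfold G; infer_instance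

/-- The cubes modulo nine. -/
def sgn (e : Fin 3) : ZMod 9 := ![0, 1, -1] e

lemma no_sol : ∀ u v w : ZMod 9, U (u, v, w) → ¬ G (u, v, w) →
    ∀ e f g : Fin 3, u * sgn e + v * sgn f + w * sgn g = 0 →
    sgn e = 0 ∧ sgn f = 0 ∧ sgn g = 0 := by decide +kernel

lemma card_U : (Finset.univ.filter U).card = 216 := by decide +kernel
lemma card_UG : (Finset.univ.filter fun r => U r ∧ G r).card = 168 := by decide +kernel

/-- The residue vector of the first three coefficients. -/
noncomputable def f (a : Fin 4 → ℤ_[3]) : ZMod 9 × ZMod 9 × ZMod 9 :=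
  (red (a 0), red (a 1), red (a 2))

lemma exists_primitive (x : Fin 4 → ℚ_[3]) (hx : x ≠ 0) (a : Fin 4 → ℤ_[3])
    (h : (a 0 : ℚ_[3]) * x 0 ^ 3 + (a 1 : ℚ_[3]) * x 1 ^ 3 + (a 2 : ℚ_[3]) * x 2 ^ 3
            + (a 3 : ℚ_[3]) * x 3 ^ 3 = 0) :
    ∃ y : Fin 4 → ℤ_[3], (∃ i, y i = 1) ∧
      a 0 * y 0 ^ 3 + a 1 * y 1 ^ 3 + a 2 * y 2 ^ 3 + a 3 * y 3 ^ 3 = 0 := by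
  obtain ⟨i, hi⟩ := Finite.exists_max (fun i => ‖x i‖)
  have hxi : x i ≠ 0 := by
    intro h0
    apply hx
    funext j
    have := hi j
    rw [h0, norm_zero] at this
    exact norm_le_zero_iff.1 this
  have hpos : 0 < ‖x i‖ := norm_pos_iff.2 hxi
  have ex : ∀ j, ∃ z : ℤ_[3], (z : ℚ_[3]) = x j / x i := fun j =>
    ⟨⟨x j / x i, by rw [norm_div, div_le_one hpos]; exact hi j⟩, rfl⟩
  choose y hy using ex
  refine ⟨y, ⟨i, ?_⟩, ?_⟩
  · apply Subtype.ext
    exact (hy i).trans (div_self hxi)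
  · apply Subtype.ext
    have e : ((a 0 * y 0 ^ 3 + a 1 * y 1 ^ 3 + a 2 * y 2 ^ 3 + a 3 * y 3 ^ 3 : ℤ_[3]) : ℚ_[3])
        = (x i)⁻¹ ^ 3 * ((a 0 : ℚ_[3]) * x 0 ^ 3 + (a 1 : ℚ_[3]) * x 1 ^ 3
      + (a 2 : ℚ_[3]) * x 2 ^ 3 + (a 3 : ℚ_[3]) * x 3 ^ 3) := by
      push_cast
      simp only [hy, div_eq_mul_inv]
      ring
    exact e.trans (by rw [h, mul_zero]; rfl)

lemma solvable_iff (a : Fin 4 → ℤ_[3]) (hU : U (f a)) (h3 : a 3 ≠ 0)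
    (hv : (a 3).valuation = 2) :
    (∃ x : Fin 4 → ℚ_[3], x ≠ 0 ∧
          (a 0 : ℚ_[3]) * x 0 ^ 3 + (a 1 : ℚ_[3]) * x 1 ^ 3 + (a 2 : ℚ_[3]) * x 2 ^ 3
            + (a 3 : ℚ_[3]) * x 3 ^ 3 = 0) ↔ G (f a) := by
  constructor
  · rintro ⟨x, hx, h⟩
    obtain ⟨y, ⟨i, hi⟩, hy⟩ := exists_primitive x hx a h
    by_contra hG
    have h9 : red (a 3) = 0 := by
      have := (PadicInt.mem_span_pow_iff_le_valuation (a 3) h3 2).2 hv.ge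
      rw [Ideal.mem_span_singleton] at this
      rw [red_eq_zero]
      norm_num at this
      exact this
    have h27 : ¬ (27 : ℤ_[3]) ∣ a 3 := by
      intro h
      have := (PadicInt.mem_span_pow_iff_le_valuation (a 3) h3 3).1 (by
        rw [Ideal.mem_span_singleton]; norm_num; exact h)
      omega
    have hr := congrArg red hy
    simp only [map_add, map_mul, map_pow, h9, zero_mul, add_zero, map_zero] at hr
    have mem : ∀ z : ZMod 9, ∃ e, z ^ 3 = sgn e := by decide
    have z3 : ∀ z : ZMod 9, z ^ 3 = 0 → 3 * z = 0 := by decide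
    obtain ⟨s0, k0⟩ := mem (red (y 0))
    obtain ⟨s1, k1⟩ := mem (red (y 1))
    obtain ⟨s2, k2⟩ := mem (red (y 2))
    rw [k0, k1, k2] at hr
    obtain ⟨e0, e1, e2⟩ := no_sol _ _ _ hU hG _ _ _ hr
    rw [← k0] at e0
    rw [← k1] at e1
    rw [← k2] at e2
    have d0 := (red_three _).1 (z3 _ e0)
    have d1 := (red_three _).1 (z3 _ e1)
    have d2 := (red_three _).1 (z3 _ e2)
    have n1 : ¬ (3 : ℤ_[3]) ∣ 1 := by
      rw [← red_three, map_one]; decide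
    have hy3 : y 3 = 1 := by
      fin_cases i
      · exact absurd (hi ▸ d0) n1
      · exact absurd (hi ▸ d1) n1
      · exact absurd (hi ▸ d2) n1
      · exact hi
    obtain ⟨c0, d0⟩ := d0
    obtain ⟨c1, d1⟩ := d1
    obtain ⟨c2, d2⟩ := d2
    apply h27
    rw [hy3, d0, d1, d2] at hy
    exact ⟨-(a 0 * c0 ^ 3 + a 1 * c1 ^ 3 + a 2 * c2 ^ 3), by linear_combination hy⟩
  · obtain ⟨h0, h1, h2⟩ := hU
    rintro (h | h | h)
    · obtain ⟨t, ht⟩ := cube_ratio _ _ h1 h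
      refine ⟨![1, -t, 0, 0], fun h => by simpa using congrFun h 0, ?_⟩
      simp [ht]; ring
    · obtain ⟨t, ht⟩ := cube_ratio _ _ h2 h
      refine ⟨![1, 0, -t, 0], fun h => by simpa using congrFun h 0, ?_⟩
      simp [ht]; ring
    · obtain ⟨t, ht⟩ := cube_ratio _ _ h2 h
      refine ⟨![0, 1, -t, 0], fun h => by simpa using congrFun h 1, ?_⟩
      simp [ht]; ring

lemma meas_red (r : ZMod 9) : MeasurableSet {x : ℤ_[3] | red x = r} := by
  obtain ⟨c, rfl⟩ := red_surj r
  have : {x : ℤ_[3] | red x = red c} = Metric.closedBall c ((3 : ℝ) ^ (-2 : ℤ)) := by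
    ext x
    have h := PadicInt.norm_le_pow_iff_mem_span_pow (x - c) 2
    rw [Ideal.mem_span_singleton] at h
    rw [Set.mem_ofPred_eq, Metric.mem_closedBall, dist_eq_norm, ← sub_eq_zero, ← map_sub,
      red_eq_zero]
    norm_num at h ⊢
    exact h.symm
  rw [this]
  exact Metric.isClosed_closedBall.measurableSet

lemma meas_f (r : ZMod 9 × ZMod 9 × ZMod 9) : MeasurableSet (f ⁻¹' {r}) := by
  have : f ⁻¹' {r} = ((fun a => a 0) ⁻¹' {x : ℤ_[3] | red x = r.1}) ∩
      (((fun a => a 1) ⁻¹' {x : ℤ_[3] | red x = r.2.1}) ∩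
      ((fun a => a 2) ⁻¹' {x : ℤ_[3] | red x = r.2.2})) := by
    ext a
    simp [f, Prod.ext_iff]
  rw [this]
  have m : ∀ i : Fin 4, Measurable fun a : Fin 4 → ℤ_[3] => a i := fun i => measurable_pi_apply i
  exact (m 0 (meas_red _)).inter ((m 1 (meas_red _)).inter (m 2 (meas_red _)))

lemma measure_count (μ : Measure (Fin 4 → ℤ_[3])) [μ.IsAddHaarMeasure] (Q : Set ℤ_[3])
    (s : Finset (ZMod 9 × ZMod 9 × ZMod 9)) :
    μ {a | f a ∈ s ∧ a 3 ∈ Q} = s.card * μ (f ⁻¹' {0} ∩ {a | a 3 ∈ Q}) := by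
  have hs := sum_measure_preimage_singleton (μ := μ.restrict {a | a 3 ∈ Q}) s (f := f)
    (fun y _ => meas_f y)
  have hms : MeasurableSet (f ⁻¹' (s : Set (ZMod 9 × ZMod 9 × ZMod 9))) := by
    rw [← Set.biUnion_preimage_singleton]
    exact s.measurableSet_biUnion fun y _ => meas_f y
  rw [Measure.restrict_apply hms] at hs
  have e : {a | f a ∈ s ∧ a 3 ∈ Q} = f ⁻¹' (s : Set (ZMod 9 × ZMod 9 × ZMod 9)) ∩
    {a | a 3 ∈ Q} := by ext a; simp
  rw [e, ← hs, ← nsmul_eq_mul, ← Finset.sum_const]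
  refine Finset.sum_congr rfl fun r _ => ?_
  rw [Measure.restrict_apply (meas_f r)]
  obtain ⟨c0, h0⟩ := red_surj r.1
  obtain ⟨c1, h1⟩ := red_surj r.2.1
  obtain ⟨c2, h2⟩ := red_surj r.2.2
  rw [← measure_preimage_add μ ![c0, c1, c2, 0]]
  congr 1
  ext a
  simp [f, Prod.ext_iff, h0, h1, h2]
  exact Iff.rfl

lemma meas_real (μ : Measure (Fin 4 → ℤ_[3])) [μ.IsAddHaarMeasure] :
    (μ {a : Fin 4 → ℤ_[3] | ((∀ i, a i ≠ 0) ∧ (a 0).valuation = 0 ∧ (a 1).valuation = 0 ∧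
          (a 2).valuation = 0 ∧ (a 3).valuation = 2) ∧
        ∃ x : Fin 4 → ℚ_[3], x ≠ 0 ∧
          (a 0 : ℚ_[3]) * x 0 ^ 3 + (a 1 : ℚ_[3]) * x 1 ^ 3 + (a 2 : ℚ_[3]) * x 2 ^ 3
            + (a 3 : ℚ_[3]) * x 3 ^ 3 = 0}).toReal
      = (7 / 9) *
        (μ {a : Fin 4 → ℤ_[3] | (∀ i, a i ≠ 0) ∧ (a 0).valuation = 0 ∧ (a 1).valuation = 0 ∧
          (a 2).valuation = 0 ∧ (a 3).valuation = 2}).toReal := by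
  have key : ∀ a : Fin 4 → ℤ_[3], ((∀ i, a i ≠ 0) ∧ (a 0).valuation = 0 ∧
      (a 1).valuation = 0 ∧ (a 2).valuation = 0 ∧ (a 3).valuation = 2) ↔
      (U (f a) ∧ a 3 ∈ {z : ℤ_[3] | z ≠ 0 ∧ z.valuation = 2}) := by
    intro a
    simp only [U, f, ← val_zero_iff, Fin.forall_fin_succ, Set.mem_ofPred_eq]
    simp
    tauto
  have A := measure_count μ {z : ℤ_[3] | z ≠ 0 ∧ z.valuation = 2} (Finset.univ.filter U)
  have B := measure_count μ {z : ℤ_[3] | z ≠ 0 ∧ z.valuation = 2}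
    (Finset.univ.filter fun r => U r ∧ G r)
  rw [card_U] at A
  rw [card_UG] at B
  have eA : {a : Fin 4 → ℤ_[3] | (∀ i, a i ≠ 0) ∧ (a 0).valuation = 0 ∧
      (a 1).valuation = 0 ∧ (a 2).valuation = 0 ∧ (a 3).valuation = 2} =
      {a | f a ∈ Finset.univ.filter U ∧ a 3 ∈ {z : ℤ_[3] | z ≠ 0 ∧ z.valuation = 2}} := by
    ext a
    refine (key a).trans ?_
    simp
  have eB : {a : Fin 4 → ℤ_[3] | ((∀ i, a i ≠ 0) ∧ (a 0).valuation = 0 ∧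
          (a 1).valuation = 0 ∧ (a 2).valuation = 0 ∧ (a 3).valuation = 2) ∧
        ∃ x : Fin 4 → ℚ_[3], x ≠ 0 ∧
          (a 0 : ℚ_[3]) * x 0 ^ 3 + (a 1 : ℚ_[3]) * x 1 ^ 3 + (a 2 : ℚ_[3]) * x 2 ^ 3
            + (a 3 : ℚ_[3]) * x 3 ^ 3 = 0} =
      {a | f a ∈ Finset.univ.filter (fun r => U r ∧ G r) ∧
        a 3 ∈ {z : ℤ_[3] | z ≠ 0 ∧ z.valuation = 2}} := by
    ext a
    refine (and_congr_left' (key a)).trans ?_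
    change _ ↔ (f a ∈ Finset.univ.filter (fun r => U r ∧ G r) ∧ _)
    rw [Finset.mem_filter]
    constructor
    · rintro ⟨⟨h1, h2⟩, h3⟩
      exact ⟨⟨Finset.mem_univ _, h1, (solvable_iff a h1 h2.1 h2.2).1 h3⟩, h2⟩
    · rintro ⟨⟨-, h1, h3⟩, h2⟩
      exact ⟨⟨h1, h2⟩, (solvable_iff a h1 h2.1 h2.2).2 h3⟩
  rw [eA, eB, A, B, ENNReal.toReal_mul, ENNReal.toReal_mul]
  norm_num
  ring

end CubicAux

/-- For `p = 3`, among coefficient vectors `a ∈ ℤ₃⁴` with valuation vector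
`v(a) = (0,0,0,2)`, the density of those for which the diagonal cubic surface
`S_a : a₀x₀³ + a₁x₁³ + a₂x₂³ + a₃x₃³ = 0` has a `ℚ₃`-point is `7/9`;
here `μ` is the Haar measure on `ℤ₃⁴` normalized by `μ(ℤ₃⁴) = 1`. -/
theorem density_diagonal_cubic_valuation_0002_at_three
    (μ : Measure (Fin 4 → ℤ_[3])) [μ.IsAddHaarMeasure] (hμ : μ Set.univ = 1) :
    (μ {a : Fin 4 → ℤ_[3] | ((∀ i, a i ≠ 0) ∧ (a 0).valuation = 0 ∧ (a 1).valuation = 0 ∧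
          (a 2).valuation = 0 ∧ (a 3).valuation = 2) ∧
        ∃ x : Fin 4 → ℚ_[3], x ≠ 0 ∧
          (a 0 : ℚ_[3]) * x 0 ^ 3 + (a 1 : ℚ_[3]) * x 1 ^ 3 + (a 2 : ℚ_[3]) * x 2 ^ 3
            + (a 3 : ℚ_[3]) * x 3 ^ 3 = 0}).toReal
      = (7 / 9) *
        (μ {a : Fin 4 → ℤ_[3] | (∀ i, a i ≠ 0) ∧ (a 0).valuation = 0 ∧ (a 1).valuation = 0 ∧
          (a 2).valuation = 0 ∧ (a 3).valuation = 2}).toReal := by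
  exact CubicAux.meas_real μ
end
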